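/- arXiv:2411.19227 — 4 statements merged into one kernel-verified Lean document; each statement's English description precedes it below -/
import Mathlib

section
/- (Seymour) Let G = (V,E) be a finite simple graph. A vector x ∈ ℝ^E lies in the convex cone generated by the incidence vectors of the simple cycles of G (i.e., x is a finite nonnegative linear combination of incidence vectors of simple cycles) if and only if x ≥ 0 and for every cut B = δ(X) (∅ ≠ X ⊂ V) and every edge e ∈ B, x_e − Σ_{f ∈ B \ {e}} x_f ≤ 0. -/
open Classical

/-- The cut `δ(X)`: the edges of `G` with exactly one endpoint in `X`. -/
noncomputable def cutFinset {V : Type*} [Fintype V] [DecidableEq V]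
    (G : SimpleGraph V) (X : Set V) : Finset (Sym2 V) :=
  Finset.univ.filter (fun e => e ∈ G.edgeSet ∧ ∃ a b, e = s(a, b) ∧ a ∈ X ∧ b ∉ X)

namespace SeymourCone

open scoped NNReal

/-- The edges of the multigraph with endpoint maps `s` and `t` that have exactly one end in `X`. -/
noncomputable def cut {V E : Type*} [Fintype E] (s t : E → V) (X : Set V) : Finset E :=
  Finset.univ.filter fun e => ¬(s e ∈ X ↔ t e ∈ X)

/-- The incidence vector of an edge set. -/
def ind {E : Type*} [DecidableEq E] (F : Finset E) (e : E) : ℝ := if e ∈ F then 1 else 0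

/-- An edge set is even if it meets every cut in an even number of edges. -/
def EvenSet {V E : Type*} [Fintype E] [DecidableEq E] (s t : E → V) (F : Finset E) : Prop :=
  ∀ X : Set V, Even (F ∩ cut s t X).card

/-- The cone generated by the incidence vectors of even edge sets. -/
noncomputable def evenCone {V E : Type*} [Fintype E] [DecidableEq E] (s t : E → V) :
    Submodule ℝ≥0 (E → ℝ) :=
  Submodule.span ℝ≥0 {y | ∃ F, EvenSet s t F ∧ y = ind F}

/-- Nonnegative vectors in which no edge outweighs the rest of a cut containing it. -/
def Balanced {V E : Type*} [Fintype E] (s t : E → V) (x : E → ℝ) : Prop :=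
  (∀ e, 0 ≤ x e) ∧ ∀ X : Set V, ∀ e ∈ cut s t X, 2 * x e ≤ ∑ f ∈ cut s t X, x f

/-- The support of a vector. -/
noncomputable def supp {E : Type*} [Fintype E] (x : E → ℝ) : Finset E :=
  Finset.univ.filter fun e => x e ≠ 0

section Basic

variable {V E : Type*} [Fintype E] {s t : E → V}

lemma mem_cut {X : Set V} {e : E} : e ∈ cut s t X ↔ ¬(s e ∈ X ↔ t e ∈ X) := by
  simp [cut]

lemma mem_supp {x : E → ℝ} {e : E} : e ∈ supp x ↔ x e ≠ 0 := by simp [supp]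

lemma cut_compl (X : Set V) : cut s t Xᶜ = cut s t X := by
  ext e; simp only [mem_cut, Set.mem_compl_iff]; tauto

lemma cut_comp {V' : Type*} (π : V → V') (Y : Set V') :
    cut (π ∘ s) (π ∘ t) Y = cut s t (π ⁻¹' Y) := by
  ext e; simp [mem_cut]

variable [DecidableEq E]

lemma even_card_symmDiff {α : Type*} [DecidableEq α] (A B : Finset α) :
    Even (symmDiff A B).card ↔ (Even A.card ↔ Even B.card) := by
  have h1 := Finset.card_sdiff_add_card_inter A B
  have h2 := Finset.card_sdiff_add_card_inter B A
  have h3 : (symmDiff A B).card = (A \ B).card + (B \ A).card := by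
    rw [symmDiff_def, Finset.sup_eq_union, Finset.card_union_of_disjoint]
    exact disjoint_sdiff_sdiff
  rw [Finset.inter_comm] at h2
  rw [h3, ← h1, ← h2]
  simp only [Nat.even_add]
  tauto

lemma inter_cut_symmDiff (F : Finset E) (X Y : Set V) :
    F ∩ cut s t (symmDiff X Y) = symmDiff (F ∩ cut s t X) (F ∩ cut s t Y) := by
  ext e
  simp only [Finset.mem_inter, Finset.mem_symmDiff, mem_cut, Set.mem_symmDiff]
  tauto

lemma even_inter_cut_symmDiff (F : Finset E) (X Y : Set V) :
    Even (F ∩ cut s t (symmDiff X Y)).card ↔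
      (Even (F ∩ cut s t X).card ↔ Even (F ∩ cut s t Y).card) := by
  rw [inter_cut_symmDiff, even_card_symmDiff]

lemma smul_mem_evenCone {x : E → ℝ} (hx : x ∈ evenCone s t) {c : ℝ} (hc : 0 ≤ c) :
    c • x ∈ evenCone s t :=
  (evenCone s t).smul_mem ⟨c, hc⟩ hx

lemma ind_mem_evenCone {F : Finset E} (hF : EvenSet s t F) : ind F ∈ evenCone s t :=
  Submodule.subset_span ⟨F, hF, rfl⟩

omit [Fintype E] in
lemma ind_nonneg (F : Finset E) (e : E) : 0 ≤ ind F e := by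
  unfold ind; split <;> norm_num

omit [Fintype E] in
lemma sum_ind (F A : Finset E) : ∑ e ∈ A, ind F e = ((F ∩ A).card : ℝ) := by
  simp [ind, Finset.sum_ite_mem, Finset.inter_comm]

/-- Members of the cone decompose into even subsets of their support. -/
lemma exists_decomposition {x : E → ℝ} (hx : x ∈ evenCone s t) :
    ∃ (n : ℕ) (c : Fin n → ℝ) (F : Fin n → Finset E), (∀ i, 0 < c i) ∧
      (∀ i, EvenSet s t (F i)) ∧ (∀ i, ∀ e ∈ F i, x e ≠ 0) ∧
      ∀ e, x e = ∑ i, c i * ind (F i) e := by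
  obtain ⟨n, c, g, hg⟩ := Submodule.mem_span_set'.1 hx
  choose F hF hgF using fun i => (g i).2
  have hxe : ∀ e, x e = ∑ i, (c i : ℝ) * ind (F i) e := by
    intro e
    rw [← hg, Finset.sum_apply]
    exact Finset.sum_congr rfl fun i _ => by rw [Pi.smul_apply, hgF]; rfl
  have hpos : ∀ i, c i ≠ 0 → (0 : ℝ) < c i := fun i hi =>
    lt_of_le_of_ne (c i).2 (by exact_mod_cast hi.symm)
  refine ⟨n, fun i => if c i = 0 then 1 else c i, fun i => if c i = 0 then ∅ else F i,
    ?_, ?_, ?_, ?_⟩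
  · intro i
    dsimp only
    split
    · exact one_pos
    · exact hpos i ‹_›
  · intro i
    dsimp only
    split
    · intro X; simp
    · exact hF i
  · intro i e he
    dsimp only at he
    split at he
    · simp at he
    · rename_i hc
      have h1 : (c i : ℝ) * ind (F i) e ≤ x e := by
        rw [hxe]
        exact Finset.single_le_sum (f := fun i => (c i : ℝ) * ind (F i) e)
          (fun j _ => mul_nonneg (c j).2 (ind_nonneg _ _)) (Finset.mem_univ i)
      have h2 := hpos i hc
      rw [ind, if_pos he] at h1
      linarith
  · intro e
    rw [hxe]
    refine Finset.sum_congr rfl fun i _ => ?_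
    dsimp only
    split
    · rename_i hc; simp [hc, ind]
    · rfl

omit [DecidableEq E] in
lemma Balanced.contract {V' : Type*} {x x' : E → ℝ} (hx : Balanced s t x) (π : V → V')
    (h0 : ∀ e, 0 ≤ x' e) (h : ∀ e, π (s e) ≠ π (t e) → x' e = x e) :
    Balanced (π ∘ s) (π ∘ t) x' := by
  refine ⟨h0, fun Y e he => ?_⟩
  have key : ∀ g ∈ cut s t (π ⁻¹' Y), x' g = x g := by
    intro g hg
    refine h g fun hst => ?_
    rw [mem_cut, Set.mem_preimage, Set.mem_preimage, hst] at hg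
    exact hg Iff.rfl
  rw [cut_comp] at he ⊢
  rw [key e he, Finset.sum_congr rfl key]
  exact hx.2 _ _ he

/-- Reduction of a cut with exactly two edges in the support. -/
lemma mem_of_two_edge_cut {x : E → ℝ} (hx : Balanced s t x)
    (ih : ∀ (s' t' : E → V) (x' : E → ℝ), Balanced s' t' x' →
      (supp x').card < (supp x).card → x' ∈ evenCone s' t')
    (X : Set V) {e f : E} (hef : e ≠ f) (hxe : x e = x f) (he : x e ≠ 0)
    (hcut : ∀ g, x g ≠ 0 → (g ∈ cut s t X ↔ g = e ∨ g = f)) : x ∈ evenCone s t := by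
  set π : V → V := fun v => if v = s e then t e else v with hπ
  have hx' : Balanced (π ∘ s) (π ∘ t) (Function.update x e 0) := by
    refine hx.contract π ?_ ?_
    · intro g
      by_cases hg : g = e
      · simp [hg]
      · simpa [hg] using hx.1 g
    · intro g hg
      refine Function.update_of_ne ?_ _ _
      rintro rfl
      simp only [hπ] at hg
      grind
  have hcard : (supp (Function.update x e 0)).card < (supp x).card := by
    refine Finset.card_lt_card ⟨?_, ?_⟩
    · intro g hg
      rw [mem_supp] at hg ⊢
      by_cases hge : g = e
      · simp [hge] at hg
      · simpa [hge] using hg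
    · intro h
      have := h (mem_supp.2 he)
      simp [mem_supp] at this
  obtain ⟨n, c, F, hc, hF, hsub, hsum⟩ := exists_decomposition (ih _ _ _ hx' hcard)
  have heF : ∀ i, e ∉ F i := fun i hi => by simpa using hsub i e hi
  have hsub' : ∀ i, ∀ g ∈ F i, x g ≠ 0 := fun i g hg => by
    have hge : g ≠ e := fun h => heF i (h ▸ hg)
    simpa [hge] using hsub i g hg
  set F' : Fin n → Finset E := fun i => if f ∈ F i then insert e (F i) else F i with hF'
  have hmem : ∀ i g, g ≠ e → (g ∈ F' i ↔ g ∈ F i) := by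
    intro i g hg
    simp only [hF']
    split <;> simp [hg]
  have hmeme : ∀ i, e ∈ F' i ↔ f ∈ F i := by
    intro i
    simp only [hF']
    split <;> simp [*]
  have hnonsep : ∀ i (Y : Set V), e ∉ cut s t Y → Even (F' i ∩ cut s t Y).card := by
    intro i Y hY
    have h1 := hF i Y
    rw [cut_comp] at h1
    by_cases hs : s e ∈ Y
    · have : π ⁻¹' Y = Y := by
        ext v; simp only [hπ, Set.mem_preimage]; rw [mem_cut] at hY; grind
      rw [this] at h1
      convert h1 using 2
      ext g; simp only [Finset.mem_inter]; grind
    · have : π ⁻¹' Y = Y := by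
        ext v; simp only [hπ, Set.mem_preimage]; rw [mem_cut] at hY; grind
      rw [this] at h1
      convert h1 using 2
      ext g; simp only [Finset.mem_inter]; grind
  have heX : e ∈ cut s t X := (hcut e he).2 (Or.inl rfl)
  have hX : ∀ i, Even (F' i ∩ cut s t X).card := by
    intro i
    by_cases hfi : f ∈ F i
    · have : F' i ∩ cut s t X = {e, f} := by
        ext g; simp only [Finset.mem_inter, Finset.mem_insert, Finset.mem_singleton]; grind
      rw [this, Finset.card_pair hef]; exact even_two
    · have : F' i ∩ cut s t X = ∅ := by
        ext g; simp only [Finset.mem_inter, Finset.notMem_empty]; grind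
      simp [this]
  have hE : ∀ i, EvenSet s t (F' i) := by
    intro i Y
    by_cases hY : e ∈ cut s t Y
    · have h1 : e ∉ cut s t (symmDiff Y X) := by
        simp only [mem_cut, Set.mem_symmDiff] at hY heX ⊢; tauto
      have h2 := hnonsep i _ h1
      rw [even_inter_cut_symmDiff] at h2
      exact h2.2 (hX i)
    · exact hnonsep i Y hY
  have hx : x = ∑ i, c i • ind (F' i) := by
    ext g
    rw [Finset.sum_apply]
    simp only [Pi.smul_apply, smul_eq_mul]
    by_cases hg : g = e
    · subst hg
      have := hsum f
      rw [Function.update_of_ne hef.symm] at this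
      rw [hxe, this]
      exact Finset.sum_congr rfl fun i _ => by simp only [ind, hmeme]
    · have := hsum g
      rw [Function.update_of_ne hg] at this
      rw [this]
      exact Finset.sum_congr rfl fun i _ => by simp only [ind, hmem i g hg]
  rw [hx]
  exact Submodule.sum_mem _ fun i _ => smul_mem_evenCone (ind_mem_evenCone (hE i)) (hc i).le

/-- Decomposition of the part of `x` outside a tight cut, obtained by contracting `X`. -/
lemma exists_half {x : E → ℝ} (hx : Balanced s t x)
    (ih : ∀ (s' t' : E → V) (x' : E → ℝ), Balanced s' t' x' →
      (supp x').card < (supp x).card → x' ∈ evenCone s' t')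
    {X : Set V} {e : E} (heX : e ∈ cut s t X) (ht : 2 * x e = ∑ f ∈ cut s t X, x f)
    (hin : ∃ g, x g ≠ 0 ∧ s g ∈ X ∧ t g ∈ X) :
    ∃ (n : ℕ) (c : Fin n → ℝ) (F : Fin n → Finset E), (∀ i, 0 < c i) ∧
      (∀ i (Y : Set V), Disjoint Y X → Even (F i ∩ cut s t Y).card) ∧
      (∀ i, ∀ g ∈ F i, ¬(s g ∈ X ∧ t g ∈ X)) ∧
      (∀ i, ((F i ∩ cut s t X).card : ℝ) = 2 * ind (F i) e) ∧
      ∀ g, ¬(s g ∈ X ∧ t g ∈ X) → x g = ∑ i, c i * ind (F i) g := by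
  obtain ⟨g₀, hg₀, hsg₀, htg₀⟩ := hin
  set π : V → V := fun v => if v ∈ X then s g₀ else v with hπ
  set x' : E → ℝ := fun g => if s g ∈ X ∧ t g ∈ X then 0 else x g with hx'def
  have hx'eq : ∀ g, ¬(s g ∈ X ∧ t g ∈ X) → x' g = x g := fun g hg => if_neg hg
  have hx' : Balanced (π ∘ s) (π ∘ t) x' := by
    refine hx.contract π ?_ ?_
    · intro g
      simp only [hx'def]
      split
      · exact le_rfl
      · exact hx.1 g
    · intro g hg
      refine if_neg fun h => hg ?_
      simp [hπ, h.1, h.2]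
  have hcard : (supp x').card < (supp x).card := by
    refine Finset.card_lt_card ⟨?_, ?_⟩
    · intro g hg
      rw [mem_supp] at hg ⊢
      simp only [hx'def] at hg
      split at hg
      · exact absurd rfl hg
      · exact hg
    · intro h
      have := h (mem_supp.2 hg₀)
      simp [mem_supp, hx'def, hsg₀, htg₀] at this
  obtain ⟨n, c, F, hc, hF, hsub, hsum⟩ := exists_decomposition (ih _ _ _ hx' hcard)
  have hcutX : ∀ g ∈ cut s t X, ¬(s g ∈ X ∧ t g ∈ X) := fun g hg => by
    rw [mem_cut] at hg; tauto
  have hevenX : ∀ i, Even (F i ∩ cut s t X).card := by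
    intro i
    have h1 := hF i X
    rw [cut_comp] at h1
    have : π ⁻¹' X = X := by
      ext v; simp only [hπ, Set.mem_preimage]; split <;> simp_all
    rwa [this] at h1
  have hterm : ∀ i, 0 ≤ c i * (((F i ∩ cut s t X).card : ℝ) - 2 * ind (F i) e) := by
    intro i
    refine mul_nonneg (hc i).le ?_
    by_cases hei : e ∈ F i
    · have h1 : 0 < (F i ∩ cut s t X).card :=
        Finset.card_pos.2 ⟨e, Finset.mem_inter.2 ⟨hei, heX⟩⟩
      have h2 : 2 ≤ (F i ∩ cut s t X).card := by
        obtain ⟨k, hk⟩ := hevenX i; omega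
      have h3 : (2 : ℝ) ≤ (F i ∩ cut s t X).card := by exact_mod_cast h2
      simp only [ind, if_pos hei]; linarith
    · simp [ind, hei]
  have hzero : ∑ i, c i * (((F i ∩ cut s t X).card : ℝ) - 2 * ind (F i) e) = 0 := by
    have h1 : ∑ f ∈ cut s t X, x f = ∑ i, c i * ((F i ∩ cut s t X).card : ℝ) := by
      rw [Finset.sum_congr rfl fun f hf => (hx'eq f (hcutX f hf)).symm.trans (hsum f),
        Finset.sum_comm]
      exact Finset.sum_congr rfl fun i _ => by rw [← Finset.mul_sum, sum_ind]
    have h2 := (hx'eq e (hcutX e heX)).symm.trans (hsum e)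
    rw [h1, h2, Finset.mul_sum] at ht
    simp only [mul_sub, Finset.sum_sub_distrib]
    rw [← ht, sub_eq_zero]
    exact Finset.sum_congr rfl fun i _ => by ring
  refine ⟨n, c, F, hc, ?_, ?_, ?_, fun g hg => (hx'eq g hg).symm.trans (hsum g)⟩
  · intro i Y hY
    have h1 := hF i Y
    rw [cut_comp] at h1
    have : π ⁻¹' Y = Y := by
      ext v
      simp only [hπ, Set.mem_preimage]
      split
      · rename_i hv
        exact iff_of_false (fun h => Set.disjoint_left.1 hY h hsg₀)
          (fun h => Set.disjoint_left.1 hY h hv)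
      · rfl
    rwa [this] at h1
  · intro i g hg h
    exact hsub i g hg (if_pos h)
  · intro i
    have h1 := (Finset.sum_eq_zero_iff_of_nonneg fun i _ => hterm i).1 hzero i (Finset.mem_univ i)
    rcases mul_eq_zero.1 h1 with h | h
    · exact absurd h (hc i).ne'
    · linarith

omit [Fintype E] in
/-- An edge set meeting a cut `B ∋ e` in `2 * [e ∈ F]` edges meets it in nothing or in a pair. -/
lemma inter_eq_pair {F B : Finset E} {e f : E} (heB : e ∈ B)
    (hcard : ((F ∩ B).card : ℝ) = 2 * ind F e) (hf : f ∈ B.erase e) (hfF : f ∈ F) :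
    e ∈ F ∧ F ∩ B = {e, f} := by
  have hfB := Finset.mem_of_mem_erase hf
  have hne := Finset.ne_of_mem_erase hf
  by_cases he : e ∈ F
  · refine ⟨he, ?_⟩
    simp only [ind, if_pos he] at hcard
    have h2 : (F ∩ B).card = 2 := by
      rw [mul_one] at hcard; exact_mod_cast hcard
    refine (Finset.eq_of_subset_of_card_le ?_ ?_).symm
    · intro g hg
      simp only [Finset.mem_insert, Finset.mem_singleton] at hg
      rcases hg with rfl | rfl <;> simp [*]
    · rw [h2, Finset.card_pair hne.symm]
  · simp only [ind, if_neg he, mul_zero, Nat.cast_eq_zero, Finset.card_eq_zero] at hcard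
    have : f ∈ F ∩ B := Finset.mem_inter.2 ⟨hfF, hfB⟩
    simp [hcard] at this

omit [Fintype E] in
lemma sum_erase_ind {F B : Finset E} {e : E} (heB : e ∈ B)
    (hcard : ((F ∩ B).card : ℝ) = 2 * ind F e) : ∑ f ∈ B.erase e, ind F f = ind F e := by
  have h := Finset.add_sum_erase B (ind F) heB
  rw [sum_ind F B, hcard] at h
  linarith

/-- Reduction of a tight cut with edges of the support inside both sides. -/
lemma mem_of_tight_cut {x : E → ℝ} (hx : Balanced s t x)
    (ih : ∀ (s' t' : E → V) (x' : E → ℝ), Balanced s' t' x' →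
      (supp x').card < (supp x).card → x' ∈ evenCone s' t')
    {X : Set V} {e : E} (heX : e ∈ cut s t X) (ht : 2 * x e = ∑ f ∈ cut s t X, x f)
    (hin : ∃ g, x g ≠ 0 ∧ s g ∈ X ∧ t g ∈ X)
    (hout : ∃ g, x g ≠ 0 ∧ s g ∉ X ∧ t g ∉ X) : x ∈ evenCone s t := by
  obtain ⟨n, c, F, hc, hF, hFX, hFB, hFx⟩ := exists_half hx ih heX ht hin
  obtain ⟨m, d, H, hd, hH, hHX, hHB, hHx⟩ :=
    exists_half (X := Xᶜ) hx ih (by rwa [cut_compl]) (by rwa [cut_compl]) hout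
  simp only [cut_compl] at hHB
  set B := cut s t X with hB
  have hcutB : ∀ g, g ∈ B ↔ ¬(s g ∈ X ∧ t g ∈ X) ∧ ¬(s g ∈ Xᶜ ∧ t g ∈ Xᶜ) := fun g => by
    rw [hB, mem_cut]; simp only [Set.mem_compl_iff]; tauto
  have evenF : ∀ (A C : Finset E), (∀ Y : Set V, Disjoint Y X → Even (A ∩ cut s t Y).card) →
      (∀ Y : Set V, Disjoint Y Xᶜ → Even (C ∩ cut s t Y).card) →
      (∀ g ∈ A, ¬(s g ∈ X ∧ t g ∈ X)) → (∀ g ∈ C, ¬(s g ∈ Xᶜ ∧ t g ∈ Xᶜ)) →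
      A ∩ B = C ∩ B → EvenSet s t (A ∪ C) := by
    intro A C hA hC hAX hCX hAC Y
    have hY : Y = symmDiff (Y \ X) (Y ∩ X) := by
      ext v; simp only [Set.mem_symmDiff, Set.mem_sdiff, Set.mem_inter_iff]; tauto
    have hiff : ∀ g ∈ B, (g ∈ A ↔ g ∈ C) := fun g hg => by
      have := Finset.ext_iff.1 hAC g
      simpa [hg] using this
    have h1 : (A ∪ C) ∩ cut s t (Y \ X) = A ∩ cut s t (Y \ X) := by
      ext g
      simp only [Finset.mem_inter, Finset.mem_union]
      have h1 := hiff g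
      have h2 := hCX g
      rw [hcutB] at h1
      simp only [mem_cut, Set.mem_sdiff, Set.mem_compl_iff] at *
      tauto
    have h2 : (A ∪ C) ∩ cut s t (Y ∩ X) = C ∩ cut s t (Y ∩ X) := by
      ext g
      simp only [Finset.mem_inter, Finset.mem_union]
      have h1 := hiff g
      have h2 := hAX g
      rw [hcutB] at h1
      simp only [mem_cut, Set.mem_inter_iff, Set.mem_compl_iff] at *
      tauto
    rw [hY, even_inter_cut_symmDiff, h1, h2]
    refine iff_of_true (hA _ Set.disjoint_sdiff_left) (hC _ ?_)
    exact Set.disjoint_compl_right_iff_subset.2 Set.inter_subset_right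
  have hempty : ∀ A : Finset E, ((A ∩ B).card : ℝ) = 2 * ind A e → e ∉ A → A ∩ B = ∅ := by
    intro A hA he
    simpa [ind, he] using hA
  have key : x = ∑ i, (c i * (1 - ind (F i) e)) • ind (F i) +
      ∑ j, (d j * (1 - ind (H j) e)) • ind (H j) +
      ∑ f ∈ B.erase e, ∑ i, ∑ j, (ind (F i) f * c i * (ind (H j) f * d j) / x f) •
        ind (F i ∪ H j) := by
    have hxB : ∀ f ∈ B.erase e, x f = ∑ i, ind (F i) f * c i ∧
        x f = ∑ j, ind (H j) f * d j := by
      intro f hf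
      have := (hcutB f).1 (Finset.mem_of_mem_erase hf)
      rw [Finset.sum_congr rfl fun i _ => mul_comm (ind (F i) f) (c i),
        Finset.sum_congr rfl fun j _ => mul_comm (ind (H j) f) (d j)]
      exact ⟨hFx f this.1, hHx f this.2⟩
    ext g
    have hpair : ∀ f ∈ B.erase e, ∑ i, ∑ j, (ind (F i) f * c i * (ind (H j) f * d j) / x f) *
        ind (F i ∪ H j) g = ∑ i, ind (F i) f * c i * ind (F i) g +
          ∑ j, ind (H j) f * d j * ind (H j) g - x f * ind {e, f} g := by
      intro f hf
      obtain ⟨hxF, hxH⟩ := hxB f hf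
      have h1 : ∀ i j, (ind (F i) f * c i * (ind (H j) f * d j) / x f) * ind (F i ∪ H j) g =
          (ind (F i) f * c i * ind (F i) g) * (ind (H j) f * d j) / x f +
          (ind (H j) f * d j * ind (H j) g) * (ind (F i) f * c i) / x f -
          (ind (F i) f * c i) * (ind (H j) f * d j) / x f * ind {e, f} g := by
        intro i j
        by_cases hfi : f ∈ F i
        · by_cases hfj : f ∈ H j
          · have hFi := (inter_eq_pair heX (hFB i) hf hfi).2
            have hHj := (inter_eq_pair heX (hHB j) hf hfj).2
            have h2 : ind (F i ∪ H j) g = ind (F i) g + ind (H j) g - ind {e, f} g := by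
              have h3 : g ∈ ({e, f} : Finset E) ↔ g ∈ F i ∧ g ∈ H j := by
                constructor
                · intro hg
                  exact ⟨(Finset.mem_inter.1 (hFi ▸ hg)).1, (Finset.mem_inter.1 (hHj ▸ hg)).1⟩
                · rintro ⟨h3, h4⟩
                  rw [← hFi]
                  exact Finset.mem_inter.2 ⟨h3, (hcutB g).2 ⟨hFX i g h3, hHX j g h4⟩⟩
              simp only [ind, h3, Finset.mem_union]
              by_cases h4 : g ∈ F i <;> by_cases h5 : g ∈ H j <;> simp [h4, h5]
            rw [h2]; ring
          · simp [ind, hfj]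
        · simp [ind, hfi]
      simp only [h1, Finset.sum_add_distrib, Finset.sum_sub_distrib, ← Finset.mul_sum,
        ← Finset.sum_mul, ← Finset.sum_div]
      simp only [← hxF, ← hxH]
      by_cases hxf : x f = 0
      · have hz : ∀ i, ind (F i) f * c i = 0 := fun i =>
          (Finset.sum_eq_zero_iff_of_nonneg fun i _ =>
            mul_nonneg (ind_nonneg _ _) (hc i).le).1 (hxF.symm.trans hxf) i (Finset.mem_univ i)
        have hz' : ∀ j, ind (H j) f * d j = 0 := fun j =>
          (Finset.sum_eq_zero_iff_of_nonneg fun j _ =>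
            mul_nonneg (ind_nonneg _ _) (hd j).le).1 (hxH.symm.trans hxf) j (Finset.mem_univ j)
        simp [hxf, hz, hz']
      · field_simp
    simp only [Pi.add_apply, Finset.sum_apply, Pi.smul_apply, smul_eq_mul]
    rw [Finset.sum_congr rfl hpair]
    simp only [Finset.sum_add_distrib, Finset.sum_sub_distrib]
    rw [Finset.sum_comm, Finset.sum_comm (s := B.erase e) (t := (Finset.univ : Finset (Fin m)))]
    simp only [← Finset.sum_mul, sum_erase_ind heX (hFB _), sum_erase_ind heX (hHB _)]
    have hlast : ∑ f ∈ B.erase e, x f * ind {e, f} g = if g ∈ B then x g else 0 := by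
      have hsumB : ∑ f ∈ B.erase e, x f = x e := by
        have := Finset.add_sum_erase B x heX
        linarith
      by_cases hge : g = e
      · subst hge
        rw [if_pos heX, ← hsumB]
        exact Finset.sum_congr rfl fun f _ => by simp [ind]
      · have : ∀ f ∈ B.erase e, x f * ind {e, f} g = if g = f then x f else 0 := by
          intro f _
          simp [ind, hge]
        rw [Finset.sum_congr rfl this, Finset.sum_ite_eq]
        simp [hge]
    rw [hlast]
    have hcF : ∑ i, c i * (1 - ind (F i) e) * ind (F i) g + ∑ i, ind (F i) e * c i * ind (F i) g =
        ∑ i, c i * ind (F i) g := by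
      rw [← Finset.sum_add_distrib]; exact Finset.sum_congr rfl fun i _ => by ring
    have hdH : ∑ j, d j * (1 - ind (H j) e) * ind (H j) g + ∑ j, ind (H j) e * d j * ind (H j) g =
        ∑ j, d j * ind (H j) g := by
      rw [← Finset.sum_add_distrib]; exact Finset.sum_congr rfl fun i _ => by ring
    have hfinal : x g = ∑ i, c i * ind (F i) g + ∑ j, d j * ind (H j) g -
        if g ∈ B then x g else 0 := by
      by_cases h1 : s g ∈ X ∧ t g ∈ X
      · have h2 : ¬(s g ∈ Xᶜ ∧ t g ∈ Xᶜ) := fun h => h.1 h1.1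
        have h3 : g ∉ B := fun h => ((hcutB g).1 h).1 h1
        have h4 : ∑ i, c i * ind (F i) g = 0 := Finset.sum_eq_zero fun i _ => by
          rw [ind, if_neg fun h => hFX i g h h1, mul_zero]
        rw [← hHx g h2, h4, if_neg h3]; ring
      · by_cases h2 : s g ∈ Xᶜ ∧ t g ∈ Xᶜ
        · have h3 : g ∉ B := fun h => ((hcutB g).1 h).2 h2
          have h4 : ∑ j, d j * ind (H j) g = 0 := Finset.sum_eq_zero fun j _ => by
            rw [ind, if_neg fun h => hHX j g h h2, mul_zero]
          rw [← hFx g h1, h4, if_neg h3]; ring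
        · rw [← hFx g h1, ← hHx g h2, if_pos ((hcutB g).2 ⟨h1, h2⟩)]; ring
    linarith
  have hone : ∀ A : Finset E, 0 ≤ 1 - ind A e := by
    intro A; unfold ind; split <;> norm_num
  rw [key]
  refine Submodule.add_mem _ (Submodule.add_mem _ ?_ ?_) ?_
  · refine Submodule.sum_mem _ fun i _ => ?_
    by_cases he : e ∈ F i
    · simp [ind, he]
    · refine smul_mem_evenCone (ind_mem_evenCone ?_) (mul_nonneg (hc i).le (hone _))
      have := evenF (F i) ∅ (hF i) (by simp) (hFX i) (by simp) (by simp [hempty _ (hFB i) he])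
      simpa using this
  · refine Submodule.sum_mem _ fun j _ => ?_
    by_cases he : e ∈ H j
    · simp [ind, he]
    · refine smul_mem_evenCone (ind_mem_evenCone ?_) (mul_nonneg (hd j).le (hone _))
      have := evenF ∅ (H j) (by simp) (hH j) (by simp) (hHX j) (by simp [hempty _ (hHB j) he])
      simpa using this
  · refine Submodule.sum_mem _ fun f hf => Submodule.sum_mem _ fun i _ =>
      Submodule.sum_mem _ fun j _ => ?_
    by_cases hfi : f ∈ F i
    · by_cases hfj : f ∈ H j
      · refine smul_mem_evenCone (ind_mem_evenCone ?_) ?_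
        · exact evenF _ _ (hF i) (hH j) (hFX i) (hHX j)
            ((inter_eq_pair heX (hFB i) hf hfi).2.trans (inter_eq_pair heX (hHB j) hf hfj).2.symm)
        · exact div_nonneg (mul_nonneg (mul_nonneg (ind_nonneg _ _) (hc i).le)
            (mul_nonneg (ind_nonneg _ _) (hd j).le)) (hx.1 f)
      · simp [ind, hfj]
    · simp [ind, hfi]

lemma exists_boundary {ι : Type*} [Fintype ι] {a b : ι → ℝ} (ha : ∀ i, 0 ≤ a i)
    (hab : ∀ i, a i = 0 → b i = 0) (hneg : ∃ i, b i < 0) :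
    ∃ r : ℝ, 0 < r ∧ (∀ i, 0 ≤ a i + r * b i) ∧ ∃ i, a i ≠ 0 ∧ a i + r * b i = 0 := by
  obtain ⟨i₀, hi₀⟩ := hneg
  obtain ⟨i, hi, hmin⟩ := (Finset.univ.filter fun i => b i < 0).exists_min_image
    (fun i => a i / -b i) ⟨i₀, by simp [hi₀]⟩
  simp only [Finset.mem_filter, Finset.mem_univ, true_and] at hi hmin
  have hai : a i ≠ 0 := fun h => hi.ne (hab i h)
  have hpos : 0 < a i := lt_of_le_of_ne (ha i) hai.symm
  refine ⟨a i / -b i, div_pos hpos (by linarith), fun j => ?_, i, hai, ?_⟩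
  · by_cases hj : b j < 0
    · have := hmin j hj
      rw [le_div_iff₀ (by linarith)] at this
      linarith
    · exact add_nonneg (ha j)
        (mul_nonneg (div_pos hpos (by linarith)).le (not_lt.1 hj))
  · have : b i ≠ 0 := hi.ne
    field_simp
    simp

/-- The slacks of the inequalities defining `Balanced`. -/
noncomputable def slack {V E : Type*} [Fintype E] (s t : E → V) (x : E → ℝ) :
    E ⊕ (Set V × E) → ℝ
  | .inl e => x e
  | .inr (X, e) => if e ∈ cut s t X then ∑ f ∈ cut s t X, x f - 2 * x e else 0

omit [DecidableEq E] in
lemma balanced_iff_slack {x : E → ℝ} : Balanced s t x ↔ ∀ i, 0 ≤ slack s t x i := by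
  constructor
  · rintro ⟨h1, h2⟩ (e | ⟨X, e⟩)
    · exact h1 e
    · simp only [slack]
      split
      · have := h2 X e ‹_›; linarith
      · exact le_rfl
  · intro h
    refine ⟨fun e => h (.inl e), fun X e he => ?_⟩
    have := h (.inr (X, e))
    simp only [slack, if_pos he] at this
    linarith

omit [DecidableEq E] in
lemma slack_add_smul (x d : E → ℝ) (r : ℝ) (i : E ⊕ (Set V × E)) :
    slack s t (x + r • d) i = slack s t x i + r * slack s t d i := by
  rcases i with e | ⟨X, e⟩
  · simp [slack]
  · simp only [slack]
    split
    · simp only [Pi.add_apply, Pi.smul_apply, smul_eq_mul, Finset.sum_add_distrib,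
        ← Finset.mul_sum]
      ring
    · simp

omit [DecidableEq E] in
/-- Moving in a direction compatible with the tight inequalities until another one is tight. -/
lemma exists_move [Fintype V] {x d : E → ℝ} (hx : Balanced s t x)
    (hd : ∀ i, slack s t x i = 0 → slack s t d i = 0) (hneg : ∃ e, d e < 0) :
    ∃ r : ℝ, 0 < r ∧ Balanced s t (x + r • d) ∧ supp (x + r • d) ⊆ supp x ∧
      supp (slack s t (x + r • d)) ⊂ supp (slack s t x) := by
  obtain ⟨e, he⟩ := hneg
  obtain ⟨r, hr, h1, i, hi, hi0⟩ :=
    exists_boundary (balanced_iff_slack.1 hx) hd ⟨.inl e, he⟩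
  refine ⟨r, hr, balanced_iff_slack.2 fun i => by rw [slack_add_smul]; exact h1 i, ?_, ?_, ?_⟩
  · intro g hg
    rw [mem_supp] at hg ⊢
    intro h
    have : d g = 0 := hd (.inl g) h
    simp [h, this] at hg
  · intro j hj
    rw [mem_supp] at hj ⊢
    intro h
    rw [slack_add_smul, h, hd j h] at hj
    simp at hj
  · intro h
    have := h (mem_supp.2 hi)
    rw [mem_supp, slack_add_smul] at this
    exact this hi0

/-- If tight cuts agree with stars on the support and have at least three edges there, the tight
inequalities leave a direction that vanishes on some edge of the support. -/
lemma exists_direction {x : E → ℝ} (hx : Balanced s t x)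
    (hstar : ∀ X e, e ∈ cut s t X → x e ≠ 0 → 2 * x e = ∑ f ∈ cut s t X, x f →
      ∃ u, ∀ g, x g ≠ 0 → (g ∈ cut s t X ↔ g ∈ cut s t {u}))
    (hthree : ∀ X e, e ∈ cut s t X → x e ≠ 0 → 2 * x e = ∑ f ∈ cut s t X, x f →
      3 ≤ (cut s t X ∩ supp x).card)
    (htwo : 2 ≤ (supp x).card) :
    ∃ d : E → ℝ, (∀ i, slack s t x i = 0 → slack s t d i = 0) ∧
      ∃ e₀ e₁, x e₀ ≠ 0 ∧ d e₀ = 0 ∧ d e₁ ≠ 0 := by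
  have hsumD : ∀ (y : E → ℝ) (X : Set V), (∀ g, x g = 0 → y g = 0) →
      ∑ f ∈ cut s t X, y f = ∑ f ∈ cut s t X ∩ supp x, y f := by
    intro y X hy
    refine (Finset.sum_subset Finset.inter_subset_left fun g hg hg' => hy g ?_).symm
    by_contra h
    exact hg' (Finset.mem_inter.2 ⟨hg, mem_supp.2 h⟩)
  set T : Finset (Finset E) := Finset.univ.filter fun D => ∃ X e, e ∈ cut s t X ∧ x e ≠ 0 ∧
    2 * x e = ∑ f ∈ cut s t X, x f ∧ D = cut s t X ∩ supp x with hT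
  have hTspec : ∀ D : T, ∃ e, e ∈ D.1 ∧ 2 * x e = ∑ f ∈ D.1, x f := by
    rintro ⟨D, hD⟩
    simp only [hT, Finset.mem_filter, Finset.mem_univ, true_and] at hD
    obtain ⟨X, e, he, hxe, ht, rfl⟩ := hD
    exact ⟨e, Finset.mem_inter.2 ⟨he, mem_supp.2 hxe⟩, by rw [ht, hsumD x X fun _ h => h]⟩
  choose top htop htopsum using hTspec
  have hTthree : ∀ D ∈ T, 3 ≤ D.card := by
    intro D hD
    simp only [hT, Finset.mem_filter, Finset.mem_univ, true_and] at hD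
    obtain ⟨X, e, he, hxe, ht, rfl⟩ := hD
    exact hthree X e he hxe ht
  have hTsub : ∀ D ∈ T, D ⊆ supp x := by
    intro D hD
    simp only [hT, Finset.mem_filter, Finset.mem_univ, true_and] at hD
    obtain ⟨X, e, he, hxe, ht, rfl⟩ := hD
    exact Finset.inter_subset_right
  have hcount : T.card * 3 ≤ (supp x).card * 2 := by
    calc T.card * 3 = ∑ D ∈ T, 3 := by simp
      _ ≤ ∑ D ∈ T, (supp x ∩ D).card := Finset.sum_le_sum fun D hD => by
          rw [Finset.inter_eq_right.2 (hTsub D hD)]; exact hTthree D hD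
      _ ≤ (supp x).card * 2 := by
          refine Finset.sum_card_inter_le fun g hg => ?_
          refine (Finset.card_le_card (t := {cut s t {s g} ∩ supp x, cut s t {t g} ∩ supp x})
            fun D hD => ?_).trans Finset.card_le_two
          simp only [hT, Finset.mem_filter, Finset.mem_univ, true_and] at hD
          obtain ⟨⟨X, e, he, hxe, ht, rfl⟩, hgD⟩ := hD
          obtain ⟨u, hu⟩ := hstar X e he hxe ht
          have heq : cut s t X ∩ supp x = cut s t {u} ∩ supp x := by
            ext f
            simp only [Finset.mem_inter, mem_supp]
            have := hu f
            tauto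
          rw [heq] at hgD ⊢
          have hgu := (Finset.mem_inter.1 hgD).1
          rw [mem_cut, Set.mem_singleton_iff, Set.mem_singleton_iff] at hgu
          rw [Finset.mem_insert, Finset.mem_singleton]
          by_cases hs : s g = u
          · left; rw [hs]
          · right
            have : t g = u := by tauto
            rw [this]
  have hTcard : T.card + 1 < (supp x).card := by
    by_cases h3 : (supp x).card = 3
    · have : T ⊆ {supp x} := fun D hD => Finset.mem_singleton.2
        (Finset.eq_of_subset_of_card_le (hTsub D hD) (h3 ▸ hTthree D hD))
      have := Finset.card_le_card this
      rw [Finset.card_singleton] at this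
      omega
    · by_cases h2 : (supp x).card = 2
      · have : T = ∅ := Finset.eq_empty_of_forall_notMem fun D hD => by
          have h1 := hTthree D hD
          have h4 := Finset.card_le_card (hTsub D hD)
          omega
        rw [this, h2]; simp
      · omega
  obtain ⟨e₀, he₀⟩ : (supp x).Nonempty := Finset.card_pos.1 (by omega)
  let Φ : (E → ℝ) →ₗ[ℝ] ((Option T ⊕ {e // e ∉ supp x}) → ℝ) := LinearMap.pi fun i =>
    match i with
    | .inl none => LinearMap.proj e₀
    | .inl (some D) => ∑ f ∈ D.1, LinearMap.proj f - (2 : ℝ) • LinearMap.proj (top D)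
    | .inr e => LinearMap.proj e.1
  have hker : LinearMap.ker Φ ≠ ⊥ := by
    refine LinearMap.ker_ne_bot_of_finrank_lt ?_
    rw [Module.finrank_fintype_fun_eq_card, Module.finrank_fintype_fun_eq_card, Fintype.card_sum,
      Fintype.card_option, Fintype.card_coe]
    have h1 : Fintype.card {e // e ∉ supp x} = Fintype.card E - (supp x).card := by
      rw [Fintype.card_subtype_compl, Fintype.card_coe]
    have h2 := Finset.card_le_univ (supp x)
    omega
  obtain ⟨d, hdker, hd0⟩ := (Submodule.ne_bot_iff _).1 hker
  rw [LinearMap.mem_ker] at hdker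
  have hd₁ : d e₀ = 0 := congrFun hdker (.inl none)
  have hd₂ : ∀ D : T, ∑ f ∈ D.1, d f = 2 * d (top D) := by
    intro D
    have := congrFun hdker (.inl (some D))
    simp [Φ] at this
    linarith
  have hd₃ : ∀ g, x g = 0 → d g = 0 := fun g hg =>
    congrFun hdker (.inr ⟨g, fun h => mem_supp.1 h hg⟩)
  obtain ⟨e₁, he₁⟩ := Function.ne_iff.1 hd0
  refine ⟨d, ?_, e₀, e₁, mem_supp.1 he₀, hd₁, he₁⟩
  rintro (e | ⟨X, e⟩) hi
  · exact hd₃ e hi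
  · simp only [slack] at hi ⊢
    split at hi
    swap
    · rename_i he; rw [if_neg he]
    rename_i he
    rw [if_pos he]
    by_cases hxe : x e = 0
    · have hz := (Finset.sum_eq_zero_iff_of_nonneg fun f _ => hx.1 f).1
        (show ∑ f ∈ cut s t X, x f = 0 by rw [hxe] at hi; linarith)
      rw [Finset.sum_eq_zero fun f hf => hd₃ f (hz f hf), hd₃ e hxe]
      ring
    · have ht : 2 * x e = ∑ f ∈ cut s t X, x f := by linarith
      have hDT : cut s t X ∩ supp x ∈ T := by
        simp only [hT, Finset.mem_filter, Finset.mem_univ, true_and]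
        exact ⟨X, e, he, hxe, ht, rfl⟩
      have h1 := htop ⟨_, hDT⟩
      have h2 := htopsum ⟨_, hDT⟩
      have h3 := hd₂ ⟨_, hDT⟩
      have hte : top ⟨_, hDT⟩ = e := by
        by_contra hne
        have heD : e ∈ cut s t X ∩ supp x := Finset.mem_inter.2 ⟨he, mem_supp.2 hxe⟩
        obtain ⟨g, hg, hgne⟩ : ∃ g ∈ cut s t X ∩ supp x, g ∉ ({top ⟨_, hDT⟩, e} : Finset E) := by
          refine Finset.exists_mem_notMem_of_card_lt_card ?_
          have := hTthree _ hDT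
          rw [Finset.card_pair hne]
          omega
        simp only [Finset.mem_insert, Finset.mem_singleton, not_or] at hgne
        have hsub : ({g, top ⟨_, hDT⟩, e} : Finset E) ⊆ cut s t X ∩ supp x := by
          intro f hf
          simp only [Finset.mem_insert, Finset.mem_singleton] at hf
          rcases hf with rfl | rfl | rfl <;> assumption
        have h4 := Finset.sum_le_sum_of_subset_of_nonneg (f := x) hsub fun f _ _ => hx.1 f
        rw [Finset.sum_insert (by simp [hgne]), Finset.sum_pair hne] at h4
        rw [hsumD x X fun _ h => h] at ht
        have h5 : 0 < x g := lt_of_le_of_ne (hx.1 g) (mem_supp.1 (Finset.mem_inter.1 hg).2).symm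
        dsimp only at h2
        linarith
      rw [hte] at h3
      rw [hsumD d X hd₃, h3]
      ring

omit [DecidableEq E] in
/-- A tight cut one of whose sides contains no edge of the support is a star on the support. -/
lemma tight_cut_eq_star {x : E → ℝ} (hx : Balanced s t x) {X : Set V} {e : E}
    (heX : e ∈ cut s t X) (ht : 2 * x e = ∑ f ∈ cut s t X, x f)
    (hin : ∀ g, x g ≠ 0 → ¬(s g ∈ X ∧ t g ∈ X)) :
    ∃ u, ∀ g, x g ≠ 0 → (g ∈ cut s t X ↔ g ∈ cut s t {u}) := by
  obtain ⟨u, huX, hu⟩ : ∃ u ∈ X, e ∈ cut s t {u} := by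
    by_cases hs : s e ∈ X
    · refine ⟨s e, hs, ?_⟩
      rw [mem_cut] at heX ⊢
      intro h
      have : t e = s e := h.1 rfl
      exact heX (iff_of_true hs (this ▸ hs))
    · have hte : t e ∈ X := by rw [mem_cut] at heX; tauto
      refine ⟨t e, hte, ?_⟩
      rw [mem_cut]
      intro h
      have : s e = t e := h.2 rfl
      exact hs (this ▸ hte)
  refine ⟨u, fun g hg => ?_⟩
  have hsub : ∀ f, x f ≠ 0 → f ∈ cut s t {u} → f ∈ cut s t X := by
    intro f hf hfu
    have h1 := hin f hf
    simp only [mem_cut, Set.mem_singleton_iff] at hfu ⊢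
    by_cases h2 : s f = u
    · have : s f ∈ X := h2 ▸ huX
      tauto
    · have h3 : t f = u := by tauto
      have : t f ∈ X := h3 ▸ huX
      tauto
  refine ⟨fun hgX => ?_, hsub g hg⟩
  by_contra hgu
  have h1 := hx.2 {u} e hu
  have h2 : ∑ f ∈ cut s t {u}, x f < ∑ f ∈ cut s t X, x f := by
    have h3 : ∑ f ∈ cut s t {u}, x f = ∑ f ∈ (cut s t {u}).filter (x · ≠ 0), x f :=
      (Finset.sum_filter_ne_zero _).symm
    rw [h3]
    refine Finset.sum_lt_sum_of_subset (fun f hf => ?_) hgX (fun h => hgu ?_)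
      (lt_of_le_of_ne (hx.1 g) hg.symm) fun f _ _ => hx.1 f
    · rw [Finset.mem_filter] at hf
      exact hsub f hf.2 hf.1
    · exact (Finset.mem_filter.1 h).1
  linarith

lemma mem_evenCone_of_card_lt [Fintype V] {x : E → ℝ} (hx : Balanced s t x)
    (ih : ∀ (s' t' : E → V) (x' : E → ℝ), Balanced s' t' x' →
      (supp x').card < (supp x).card → x' ∈ evenCone s' t')
    (ih' : ∀ x' : E → ℝ, Balanced s t x' → supp x' ⊆ supp x →
      supp (slack s t x') ⊂ supp (slack s t x) → x' ∈ evenCone s t) : x ∈ evenCone s t := by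
  by_cases hsplit : ∃ X e, e ∈ cut s t X ∧ 2 * x e = ∑ f ∈ cut s t X, x f ∧
      (∃ g, x g ≠ 0 ∧ s g ∈ X ∧ t g ∈ X) ∧ ∃ g, x g ≠ 0 ∧ s g ∉ X ∧ t g ∉ X
  · obtain ⟨X, e, he, ht, hin, hout⟩ := hsplit
    exact mem_of_tight_cut hx ih he ht hin hout
  by_cases hseries : ∃ X e, e ∈ cut s t X ∧ x e ≠ 0 ∧ 2 * x e = ∑ f ∈ cut s t X, x f ∧
      (cut s t X ∩ supp x).card < 3
  · obtain ⟨X, e, he, hxe, ht, hlt⟩ := hseries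
    have heD : e ∈ cut s t X ∩ supp x := Finset.mem_inter.2 ⟨he, mem_supp.2 hxe⟩
    have hsum : ∑ f ∈ cut s t X, x f = ∑ f ∈ cut s t X ∩ supp x, x f := by
      refine (Finset.sum_subset Finset.inter_subset_left fun g hg hg' => ?_).symm
      by_contra h
      exact hg' (Finset.mem_inter.2 ⟨hg, mem_supp.2 h⟩)
    have hxepos : 0 < x e := lt_of_le_of_ne (hx.1 e) hxe.symm
    have hcard : (cut s t X ∩ supp x).card = 2 := by
      have h1 : 0 < (cut s t X ∩ supp x).card := Finset.card_pos.2 ⟨e, heD⟩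
      by_contra h2
      obtain ⟨a, ha⟩ := Finset.card_eq_one.1 (show (cut s t X ∩ supp x).card = 1 by omega)
      rw [ha] at heD
      rw [hsum, ha, Finset.sum_singleton, ← Finset.mem_singleton.1 heD] at ht
      linarith
    obtain ⟨f, hf⟩ := Finset.card_eq_one.1
      (show ((cut s t X ∩ supp x).erase e).card = 1 by rw [Finset.card_erase_of_mem heD, hcard])
    have hD : cut s t X ∩ supp x = {e, f} := by rw [← Finset.insert_erase heD, hf]
    have hef : e ≠ f := by
      rintro rfl
      simp [hD] at hcard
    refine mem_of_two_edge_cut hx ih X hef ?_ hxe fun g hg => ?_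
    · rw [hsum, hD, Finset.sum_pair hef] at ht
      linarith
    · have := Finset.ext_iff.1 hD g
      simp only [Finset.mem_inter, mem_supp, Finset.mem_insert, Finset.mem_singleton] at this
      tauto
  push Not at hsplit hseries
  by_cases htwo : 2 ≤ (supp x).card
  · obtain ⟨d, hd, e₀, e₁, he₀, hde₀, hde₁⟩ := exists_direction hx
      (fun X e he _ ht => by
        by_cases hin : ∃ g, x g ≠ 0 ∧ s g ∈ X ∧ t g ∈ X
        · have hout := hsplit X e he ht hin
          obtain ⟨u, hu⟩ := tight_cut_eq_star (X := Xᶜ) hx (by rwa [cut_compl])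
            (by rwa [cut_compl]) fun g hg h => h.2 (hout g hg h.1)
          exact ⟨u, by simpa only [cut_compl] using hu⟩
        · exact tight_cut_eq_star hx he ht fun g hg h => hin ⟨g, hg, h⟩)
      hseries htwo
    have hxe₁ : x e₁ ≠ 0 := fun h => hde₁ (hd (.inl e₁) h)
    have hx₀ : 0 < x e₀ := lt_of_le_of_ne (hx.1 _) he₀.symm
    have hx₁ : 0 < x e₁ := lt_of_le_of_ne (hx.1 _) hxe₁.symm
    obtain ⟨y, hy, hneg, hpos⟩ : ∃ y : E → ℝ, (∀ i, slack s t x i = 0 → slack s t y i = 0) ∧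
        (∃ e, y e < 0) ∧ ∃ e, 0 < y e := by
      refine ⟨d + (-(d e₁ / (2 * x e₁))) • x, fun i hi => ?_, ?_⟩
      · rw [slack_add_smul, hi, hd i hi]; ring
      · have h0 : (d + (-(d e₁ / (2 * x e₁))) • x) e₀ = -(d e₁ * (x e₀ / (2 * x e₁))) := by
          simp [hde₀]; ring
        have h1 : (d + (-(d e₁ / (2 * x e₁))) • x) e₁ = d e₁ / 2 := by
          simp; field_simp; ring
        have hq : 0 < x e₀ / (2 * x e₁) := by positivity
        rcases lt_or_gt_of_ne hde₁ with h | h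
        · exact ⟨⟨e₁, by rw [h1]; linarith⟩, e₀, by rw [h0]; nlinarith⟩
        · exact ⟨⟨e₀, by rw [h0]; nlinarith⟩, e₁, by rw [h1]; linarith⟩
    obtain ⟨r, hr, hb, hs, hsl⟩ := exists_move hx hy hneg
    have hy' : ∀ i, slack s t x i = 0 → slack s t (-y) i = 0 := fun i hi => by
      have := slack_add_smul (s := s) (t := t) (0 : E → ℝ) y (-1) i
      have h0 := slack_add_smul (s := s) (t := t) (0 : E → ℝ) 0 1 i
      rw [zero_add, neg_one_smul, hy i hi] at this
      simp only [smul_zero, add_zero, one_mul] at h0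
      linarith
    obtain ⟨r', hr', hb', hs', hsl'⟩ := exists_move hx hy'
      (by obtain ⟨e, he⟩ := hpos; exact ⟨e, by simpa using he⟩)
    have hxeq : x = (r' / (r + r')) • (x + r • y) + (r / (r + r')) • (x + r' • (-y)) := by
      ext g
      simp
      field_simp
      ring
    rw [hxeq]
    exact Submodule.add_mem _ (smul_mem_evenCone (ih' _ hb hs hsl) (by positivity))
      (smul_mem_evenCone (ih' _ hb' hs' hsl') (by positivity))
  · by_cases hx0 : x = 0
    · rw [hx0]
      exact Submodule.zero_mem _
    obtain ⟨e, hxe⟩ : ∃ e, x e ≠ 0 := Function.ne_iff.1 hx0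
    have hxz : ∀ g, g ≠ e → x g = 0 := fun g hg => by
      by_contra h
      exact hg (Finset.card_le_one.1 (by omega) g (mem_supp.2 h) e (mem_supp.2 hxe))
    have hxeq : x = x e • ind {e} := by
      ext g
      by_cases hg : g = e
      · simp [hg, ind]
      · simp [hxz g hg, ind, hg]
    rw [hxeq]
    refine smul_mem_evenCone (ind_mem_evenCone fun X => ?_) (hx.1 e)
    have : e ∉ cut s t X := fun h => by
      have h1 := hx.2 X e h
      rw [Finset.sum_eq_single_of_mem e h fun g _ hg => hxz g hg] at h1
      exact hxe (le_antisymm (by linarith) (hx.1 e))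
    rw [Finset.singleton_inter_of_notMem this]
    simp

theorem Balanced.mem_evenCone [Fintype V] {s t : E → V} {x : E → ℝ} (hx : Balanced s t x) :
    x ∈ evenCone s t := by
  induction hn : (supp x).card using Nat.strong_induction_on generalizing s t x with
  | _ n ih =>
    have ihn : ∀ (s' t' : E → V) (x' : E → ℝ), Balanced s' t' x' →
        (supp x').card < n → x' ∈ evenCone s' t' := fun s' t' x' h1 h2 => ih _ h2 h1 rfl
    clear ih
    replace hn := hn.le
    induction hm : (supp (slack s t x)).card using Nat.strong_induction_on generalizing x with
    | _ m ih =>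
      refine mem_evenCone_of_card_lt hx
        (fun s' t' x' h1 h2 => ihn s' t' x' h1 (h2.trans_le hn)) fun x' h1 h2 h3 => ?_
      exact ih _ (hm ▸ Finset.card_lt_card h3) h1 ((Finset.card_le_card h2).trans hn) rfl

lemma balanced_ind {F : Finset E}
    (hF : EvenSet s t F) : Balanced s t (ind F) := by
  refine ⟨ind_nonneg F, fun X e he => ?_⟩
  rw [sum_ind]
  by_cases heF : e ∈ F
  · have h1 : 0 < (F ∩ cut s t X).card := Finset.card_pos.2 ⟨e, Finset.mem_inter.2 ⟨heF, he⟩⟩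
    obtain ⟨k, hk⟩ := hF X
    have h2 : 2 ≤ (F ∩ cut s t X).card := by omega
    have h3 : (2 : ℝ) ≤ (F ∩ cut s t X).card := by exact_mod_cast h2
    simpa [ind, heF] using h3
  · simp [ind, heF]

lemma balanced_of_mem_evenCone {x : E → ℝ}
    (hx : x ∈ evenCone s t) : Balanced s t x := by
  induction hx using Submodule.span_induction with
  | mem y hy =>
    obtain ⟨F, hF, rfl⟩ := hy
    exact balanced_ind hF
  | zero => exact ⟨fun e => le_rfl, fun X e _ => by simp⟩
  | add y z _ _ hy hz =>
    refine ⟨fun e => add_nonneg (hy.1 e) (hz.1 e), fun X e he => ?_⟩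
    simp only [Pi.add_apply, Finset.sum_add_distrib]
    have := hy.2 X e he
    have := hz.2 X e he
    linarith
  | smul c y _ hy =>
    refine ⟨fun e => mul_nonneg c.2 (hy.1 e), fun X e he => ?_⟩
    simp only [Pi.smul_apply, NNReal.smul_def, smul_eq_mul, ← Finset.mul_sum]
    have := mul_le_mul_of_nonneg_left (hy.2 X e he) c.coe_nonneg
    linarith

end Basic

section Graph

variable {V : Type*} [Fintype V] [DecidableEq V] {G : SimpleGraph V}

/-- The edges of the complete graph with loops that have exactly one end in `X`. -/
noncomputable abbrev symCut (X : Set V) : Finset (Sym2 V) :=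
  cut (fun e : Sym2 V => e.out.1) (fun e => e.out.2) X

omit [DecidableEq V] in
lemma mk_mem_symCut {X : Set V} {a b : V} : s(a, b) ∈ symCut X ↔ ¬(a ∈ X ↔ b ∈ X) := by
  have h : s(s(a, b).out.1, s(a, b).out.2) = s(a, b) := Quot.out_eq s(a, b)
  rw [mem_cut]
  rcases Sym2.eq_iff.1 h with ⟨h1, h2⟩ | ⟨h1, h2⟩ <;> rw [h1, h2]
  tauto

lemma cutFinset_eq (X : Set V) :
    cutFinset G X = (symCut X).filter (· ∈ G.edgeSet) := by
  ext e
  induction e with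
  | _ a b =>
    simp only [cutFinset, Finset.mem_filter, Finset.mem_univ, true_and, mk_mem_symCut]
    constructor
    · rintro ⟨h, c, d, hcd, hc, hd⟩
      refine ⟨?_, h⟩
      rcases Sym2.eq_iff.1 hcd with ⟨rfl, rfl⟩ | ⟨rfl, rfl⟩ <;> tauto
    · rintro ⟨h, hG⟩
      refine ⟨hG, ?_⟩
      by_cases ha : a ∈ X
      · exact ⟨a, b, rfl, ha, by tauto⟩
      · exact ⟨b, a, Sym2.eq_swap, by tauto, ha⟩

lemma even_countP_symCut_iff (X : Set V) {a b : V} (W : G.Walk a b) :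
    Even (W.edges.countP (· ∈ symCut X)) ↔ (a ∈ X ↔ b ∈ X) := by
  induction W with
  | nil => simp
  | @cons a b c h p ih =>
    rw [SimpleGraph.Walk.edges_cons, List.countP_cons]
    by_cases hab : s(a, b) ∈ symCut X
    · simp only [hab, decide_true, if_true, Nat.even_add_one, ih]
      rw [mk_mem_symCut] at hab
      tauto
    · simp only [hab, decide_false, Bool.false_eq_true, if_false, add_zero, ih]
      rw [mk_mem_symCut] at hab
      tauto

lemma evenSet_edges {a : V} {W : G.Walk a a} (hW : W.IsCycle) :
    EvenSet (fun e : Sym2 V => e.out.1) (fun e => e.out.2) W.edges.toFinset := by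
  intro X
  have h := (even_countP_symCut_iff X W).2 Iff.rfl
  rw [List.countP_eq_length_filter] at h
  convert h
  rw [← List.toFinset_card_of_nodup (hW.edges_nodup.filter _)]
  congr 1
  ext e
  simp

/-- The cone generated by the incidence vectors of the cycles of `G`. -/
noncomputable def cycleCone {V : Type*} [DecidableEq V] (G : SimpleGraph V) : Submodule ℝ≥0 (Sym2 V → ℝ) :=
  Submodule.span ℝ≥0 {y | ∃ (a : V) (W : G.Walk a a), W.IsCycle ∧ y = ind W.edges.toFinset}

lemma exists_cycle_of_evenSet {F : Finset (Sym2 V)} (hFG : ∀ e ∈ F, e ∈ G.edgeSet)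
    (hF : EvenSet (fun e : Sym2 V => e.out.1) (fun e => e.out.2) F) (hne : F.Nonempty) :
    ∃ (a : V) (W : G.Walk a a), W.IsCycle ∧ W.edges.toFinset ⊆ F := by
  set H := SimpleGraph.fromEdgeSet (F : Set (Sym2 V)) with hH
  have hHF : ∀ e ∈ H.edgeSet, e ∈ F := fun e he => by
    rw [hH, SimpleGraph.edgeSet_fromEdgeSet] at he
    exact he.1
  have hle : H ≤ G := SimpleGraph.edgeSet_subset_edgeSet.1 fun e he => hFG e (hHF e he)
  have hcyc : ¬H.IsAcyclic := by
    intro hac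
    obtain ⟨e, he⟩ := hne
    induction e with
    | _ u v =>
      have hadj : H.Adj u v := by
        rw [hH, SimpleGraph.fromEdgeSet_adj]
        exact ⟨he, (SimpleGraph.mem_edgeSet G |>.1 (hFG _ he)).ne⟩
      have hbr := SimpleGraph.isAcyclic_iff_forall_adj_isBridge.1 hac hadj
      rw [SimpleGraph.isBridge_iff] at hbr
      set H' := H.deleteEdges {s(u, v)} with hH'
      have hX : F ∩ symCut {w | H'.Reachable u w} = {s(u, v)} := by
        ext f
        induction f with
        | _ a b =>
          rw [Finset.mem_inter, mk_mem_symCut, Finset.mem_singleton]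
          simp only [Set.mem_ofPred_eq]
          constructor
          · rintro ⟨hf, hab⟩
            by_contra hne
            have hadj' : H'.Adj a b := by
              rw [hH', SimpleGraph.deleteEdges_adj, hH, SimpleGraph.fromEdgeSet_adj]
              exact ⟨⟨hf, (SimpleGraph.mem_edgeSet G |>.1 (hFG _ hf)).ne⟩, hne⟩
            exact hab ⟨fun h => h.trans hadj'.reachable, fun h => h.trans hadj'.symm.reachable⟩
          · intro h
            rw [h]
            refine ⟨he, ?_⟩
            have hu : H'.Reachable u u := SimpleGraph.Reachable.refl u
            rcases Sym2.eq_iff.1 h with ⟨rfl, rfl⟩ | ⟨rfl, rfl⟩ <;> tauto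
      have := hF {w | H'.Reachable u w}
      rw [hX] at this
      simp at this
  simp only [SimpleGraph.IsAcyclic, not_forall, not_not] at hcyc
  obtain ⟨a, W, hW⟩ := hcyc
  refine ⟨a, W.mapLe hle, hW.mapLe hle, fun e he => ?_⟩
  rw [List.mem_toFinset, SimpleGraph.Walk.edges_mapLe_eq_edges] at he
  exact hHF e (W.edges_subset_edgeSet he)

lemma ind_mem_cycleCone {F : Finset (Sym2 V)} (hFG : ∀ e ∈ F, e ∈ G.edgeSet)
    (hF : EvenSet (fun e : Sym2 V => e.out.1) (fun e => e.out.2) F) : ind F ∈ cycleCone G := by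
  induction F using Finset.strongInduction with
  | H F ih =>
    rcases F.eq_empty_or_nonempty with rfl | hne
    · have : ind (∅ : Finset (Sym2 V)) = 0 := by ext e; simp [ind]
      rw [this]
      exact Submodule.zero_mem _
    · obtain ⟨a, W, hW, hWF⟩ := exists_cycle_of_evenSet hFG hF hne
      have hdecomp : ind F = ind W.edges.toFinset + ind (F \ W.edges.toFinset) := by
        ext e
        have := @hWF e
        simp only [ind, Pi.add_apply, Finset.mem_sdiff]
        by_cases h1 : e ∈ W.edges.toFinset
        · simp [h1, this h1]
        · simp [h1]
      have hWne : W.edges.toFinset.Nonempty := by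
        rw [List.toFinset_nonempty_iff]
        intro h
        have := hW.three_le_length
        rw [← SimpleGraph.Walk.length_edges, h] at this
        simp at this
      rw [hdecomp]
      refine Submodule.add_mem _ (Submodule.subset_span ⟨a, W, hW, rfl⟩)
        (ih _ (Finset.sdiff_ssubset hWF hWne) (fun e he => hFG e (Finset.mem_sdiff.1 he).1) ?_)
      intro X
      have : (F \ W.edges.toFinset) ∩ symCut X =
          symmDiff (F ∩ symCut X) (W.edges.toFinset ∩ symCut X) := by
        ext e
        have := @hWF e
        simp only [Finset.mem_inter, Finset.mem_sdiff, Finset.mem_symmDiff]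
        tauto
      rw [this, even_card_symmDiff]
      exact iff_of_true (hF X) (evenSet_edges hW X)

omit [Fintype V] in
lemma mem_cycleCone_iff {x : Sym2 V → ℝ} : x ∈ cycleCone G ↔
    ∃ (k : ℕ) (c : Fin k → ℝ) (a : Fin k → V) (W : (i : Fin k) → G.Walk (a i) (a i)),
      (∀ i, 0 ≤ c i) ∧ (∀ i, (W i).IsCycle) ∧
      (∀ e : Sym2 V, x e = ∑ i, c i * (if e ∈ (W i).edges then 1 else 0)) := by
  constructor
  · intro hx
    obtain ⟨n, c, g, hg⟩ := Submodule.mem_span_set'.1 hx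
    choose a W hW hgW using fun i => (g i).2
    refine ⟨n, fun i => c i, a, W, fun i => (c i).2, hW, fun e => ?_⟩
    rw [← hg, Finset.sum_apply]
    refine Finset.sum_congr rfl fun i _ => ?_
    rw [Pi.smul_apply, hgW]
    simp [ind, NNReal.smul_def]
  · rintro ⟨n, c, a, W, hc, hW, hx⟩
    have : x = ∑ i, (⟨c i, hc i⟩ : ℝ≥0) • ind (W i).edges.toFinset := by
      ext e
      rw [hx, Finset.sum_apply]
      refine Finset.sum_congr rfl fun i _ => ?_
      simp only [ind, Pi.smul_apply, List.mem_toFinset]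
      rfl
    rw [this]
    exact Submodule.sum_mem _ fun i _ =>
      Submodule.smul_mem _ _ (Submodule.subset_span ⟨a i, W i, hW i, rfl⟩)

lemma balanced_iff_cutFinset {x : Sym2 V → ℝ} (hxE : ∀ e, e ∉ G.edgeSet → x e = 0) :
    Balanced (fun e : Sym2 V => e.out.1) (fun e => e.out.2) x ↔
      (∀ e, 0 ≤ x e) ∧ ∀ X : Set V, X.Nonempty → X ≠ Set.univ →
        ∀ e ∈ cutFinset G X, x e - ∑ f ∈ (cutFinset G X).erase e, x f ≤ 0 := by
  have hsum : ∀ X : Set V, ∑ f ∈ cutFinset G X, x f = ∑ f ∈ symCut X, x f := by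
    intro X
    rw [cutFinset_eq]
    refine Finset.sum_subset (Finset.filter_subset _ _) fun f hf hf' => hxE f fun h => ?_
    exact hf' (Finset.mem_filter.2 ⟨hf, h⟩)
  refine and_congr_right fun h0 => ⟨fun h X _ _ e he => ?_, fun h X e he => ?_⟩
  · have h1 := Finset.add_sum_erase _ x he
    rw [hsum] at h1
    rw [cutFinset_eq, Finset.mem_filter] at he
    have h2 := h X e he.1
    linarith
  · by_cases heG : e ∈ G.edgeSet
    · have he' : e ∈ cutFinset G X := by
        rw [cutFinset_eq]
        exact Finset.mem_filter.2 ⟨he, heG⟩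
      have h1 := Finset.add_sum_erase _ x he'
      rw [hsum] at h1
      rw [mem_cut] at he
      have h2 := h X ?_ ?_ e he'
      · linarith
      · by_contra hX
        rw [Set.not_nonempty_iff_eq_empty] at hX
        simp [hX] at he
      · rintro rfl
        simp at he
    · rw [hxE e heG, mul_zero]
      exact Finset.sum_nonneg fun f _ => h0 f

lemma cycleCone_le_evenCone :
    cycleCone G ≤ evenCone (fun e : Sym2 V => e.out.1) (fun e => e.out.2) := by
  refine Submodule.span_le.2 ?_
  rintro _ ⟨a, W, hW, rfl⟩
  exact ind_mem_evenCone (evenSet_edges hW)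

lemma mem_cycleCone_of_balanced {x : Sym2 V → ℝ} (hxE : ∀ e, e ∉ G.edgeSet → x e = 0)
    (hx : Balanced (fun e : Sym2 V => e.out.1) (fun e => e.out.2) x) : x ∈ cycleCone G := by
  obtain ⟨n, c, F, hc, hF, hsub, hsum⟩ := exists_decomposition hx.mem_evenCone
  have : x = ∑ i, (⟨c i, (hc i).le⟩ : ℝ≥0) • ind (F i) := by
    ext e
    rw [hsum, Finset.sum_apply]
    rfl
  rw [this]
  refine Submodule.sum_mem _ fun i _ => Submodule.smul_mem _ _ (ind_mem_cycleCone ?_ (hF i))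
  intro e he
  by_contra h
  exact hsub i e he (hxE e h)

end Graph

end SeymourCone

/-- **Seymour.** A vector `x ∈ ℝ^E` lies in the convex cone generated by the
incidence vectors of the simple cycles of `G` iff `x ≥ 0` and, for every cut `B = δ(X)`
(`∅ ≠ X ⊂ V`) and every edge `e ∈ B`, `x e − x(B \ {e}) ≤ 0`. -/
theorem seymour_cycle_cone
    {V : Type*} [Fintype V] [DecidableEq V] (G : SimpleGraph V)
    (x : Sym2 V → ℝ) (hxE : ∀ e, e ∉ G.edgeSet → x e = 0) :
    (∃ (k : ℕ) (c : Fin k → ℝ) (a : Fin k → V) (W : (i : Fin k) → G.Walk (a i) (a i)),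
        (∀ i, 0 ≤ c i) ∧ (∀ i, (W i).IsCycle) ∧
        (∀ e : Sym2 V, x e = ∑ i, c i * (if e ∈ (W i).edges then 1 else 0))) ↔
    ((∀ e, 0 ≤ x e) ∧
      ∀ X : Set V, X.Nonempty → X ≠ Set.univ →
        ∀ e ∈ cutFinset G X, x e - ∑ f ∈ (cutFinset G X).erase e, x f ≤ 0) := by
  rw [← SeymourCone.mem_cycleCone_iff, ← SeymourCone.balanced_iff_cutFinset hxE]
  exact ⟨fun h => SeymourCone.balanced_of_mem_evenCone (SeymourCone.cycleCone_le_evenCone h),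
    SeymourCone.mem_cycleCone_of_balanced hxE⟩
end

section
/- Let G = (V,E) be a finite simple graph and c ∈ ℝ^E. There exists a vector x ∈ ℝ^E with x ≥ 0, x_e − Σ_{f ∈ B\{e}} x_f ≤ 0 for every cut B and every edge e ∈ B, and Σ_{e ∈ E} c_e x_e < 0, if and only if G contains a simple cycle C with Σ_{e ∈ C} c_e < 0. -/
open Classical

open Finset in
theorem Finset.sum_symmDiff_eq {α R : Type*} [DecidableEq α] [CommRing R] (f : α → R)
    (s t : Finset α) :
    ∑ e ∈ symmDiff s t, f e = ∑ e ∈ s, f e + ∑ e ∈ t, f e - 2 * ∑ e ∈ s ∩ t, f e := by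
  have h1 : ∑ e ∈ symmDiff s t, f e = ∑ e ∈ s \ t, f e + ∑ e ∈ t \ s, f e := by
    rw [symmDiff_def, sup_eq_union, sum_union disjoint_sdiff_sdiff]
  have h2 := sum_inter_add_sum_sdiff s t f
  have h3 := sum_inter_add_sum_sdiff t s f
  rw [inter_comm] at h3
  rw [h1]
  linear_combination h2 + h3

namespace SignedGraph

variable {V : Type*} [Fintype V] [DecidableEq V]

/-- The mod 2 degree of each vertex in an edge set. -/
def boundary (J : Finset (Sym2 V)) (v : V) : ZMod 2 :=
  ∑ e ∈ J, if v ∈ e then 1 else 0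

/-- The mod 2 indicator of a vertex. -/
def pt (v : V) : V → ZMod 2 := Pi.single v 1

theorem two_eq_zero (V : Type*) : (2 : V → ZMod 2) = 0 := by
  funext v
  exact (by decide : (2 : ZMod 2) = 0)

omit [Fintype V] in
theorem boundary_symmDiff (J K : Finset (Sym2 V)) :
    boundary (symmDiff J K) = boundary J + boundary K := by
  funext v
  have h := Finset.sum_symmDiff_eq (fun e : Sym2 V => if v ∈ e then (1 : ZMod 2) else 0) J K
  rw [(by decide : (2 : ZMod 2) = 0), zero_mul, sub_zero] at h
  exact h

omit [Fintype V] in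
@[simp] theorem boundary_empty : boundary (∅ : Finset (Sym2 V)) = 0 := by
  funext v
  simp [boundary]

omit [Fintype V] in
theorem boundary_singleton {u v : V} (h : u ≠ v) : boundary {s(u, v)} = pt u + pt v := by
  funext w
  simp only [boundary, Finset.sum_singleton, Sym2.mem_iff, pt, Pi.add_apply, Pi.single_apply]
  by_cases hu : w = u <;> by_cases hv : w = v <;> simp_all

theorem mem_cutFinset {G : SimpleGraph V} {X : Set V} {e : Sym2 V} :
    e ∈ cutFinset G X ↔ e ∈ G.edgeSet ∧ ∃ a b, e = s(a, b) ∧ a ∈ X ∧ b ∉ X := by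
  simp [cutFinset]

theorem mk_mem_cutFinset {G : SimpleGraph V} {X : Set V} {u v : V} :
    s(u, v) ∈ cutFinset G X ↔ G.Adj u v ∧ ¬ (u ∈ X ↔ v ∈ X) := by
  rw [mem_cutFinset, SimpleGraph.mem_edgeSet]
  refine and_congr_right fun _ => ⟨?_, fun h => ?_⟩
  · rintro ⟨a, b, h, ha, hb⟩
    rcases Sym2.eq_iff.1 h with ⟨rfl, rfl⟩ | ⟨rfl, rfl⟩ <;> tauto
  · by_cases hu : u ∈ X
    · exact ⟨u, v, rfl, hu, by tauto⟩
    · exact ⟨v, u, Sym2.eq_swap, by tauto, hu⟩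

theorem sum_boundary {G : SimpleGraph V} (X : Set V) {J : Finset (Sym2 V)}
    (hJ : ∀ e ∈ J, e ∈ G.edgeSet) :
    ∑ v with v ∈ X, boundary J v = ((J ∩ cutFinset G X).card : ZMod 2) := by
  have hcard : ((J ∩ cutFinset G X).card : ZMod 2) =
      ∑ e ∈ J, if e ∈ cutFinset G X then 1 else 0 := by
    rw [← Finset.filter_mem_eq_inter, Finset.sum_boole]
  rw [hcard]
  unfold boundary
  rw [Finset.sum_comm]
  refine Finset.sum_congr rfl fun e he => ?_
  have hG := hJ e he
  induction e using Sym2.ind with | _ u v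
  rw [SimpleGraph.mem_edgeSet] at hG
  have hne := hG.ne
  have hsplit : ∀ w : V, (if w ∈ s(u, v) then (1 : ZMod 2) else 0) =
      (if w = u then 1 else 0) + (if w = v then 1 else 0) := by
    intro w
    by_cases hu : w = u <;> by_cases hv : w = v <;> simp_all
  simp only [hsplit, Finset.sum_add_distrib, Finset.sum_ite_eq', Finset.mem_filter,
    Finset.mem_univ, true_and, mk_mem_cutFinset, hG]
  by_cases hu : u ∈ X <;> by_cases hv : v ∈ X <;> simp [hu, hv]
  decide

theorem sum_pt (X : Set V) (v : V) :
    ∑ w with w ∈ X, pt v w = if v ∈ X then 1 else 0 := by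
  simp [pt, Pi.single_apply]

theorem even_card_inter_cutFinset {G : SimpleGraph V} (X : Set V) {J : Finset (Sym2 V)}
    (hJ : ∀ e ∈ J, e ∈ G.edgeSet) (h : boundary J = 0) :
    Even (J ∩ cutFinset G X).card := by
  rw [← ZMod.natCast_eq_zero_iff_even, ← sum_boundary X hJ]
  simp [h]

theorem inter_cutFinset_nonempty {G : SimpleGraph V} {X : Set V} {J : Finset (Sym2 V)}
    (hJ : ∀ e ∈ J, e ∈ G.edgeSet) {u v : V} (h : boundary J = pt u + pt v)
    (huv : ¬ (u ∈ X ↔ v ∈ X)) : (J ∩ cutFinset G X).Nonempty := by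
  by_contra hempty
  rw [Finset.not_nonempty_iff_eq_empty] at hempty
  have hsum := sum_boundary X hJ
  simp only [h, hempty, Pi.add_apply, Finset.sum_add_distrib, sum_pt] at hsum
  by_cases hu : u ∈ X <;> by_cases hv : v ∈ X <;> simp_all

omit [Fintype V] in
theorem boundary_edges {G : SimpleGraph V} {u v : V} (p : G.Walk u v) (hp : p.IsTrail) :
    boundary p.edges.toFinset = pt u + pt v := by
  induction p with
  | nil =>
    rename_i u
    simp only [SimpleGraph.Walk.edges_nil, List.toFinset_nil, boundary_empty]
    linear_combination (-pt u) * two_eq_zero V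
  | cons h p ih =>
    rename_i u v w
    rw [SimpleGraph.Walk.isTrail_cons] at hp
    have hsd : (SimpleGraph.Walk.cons h p).edges.toFinset =
        symmDiff {s(u, v)} p.edges.toFinset := by
      have : Disjoint ({s(u, v)} : Finset (Sym2 V)) p.edges.toFinset := by simpa using hp.2
      rw [this.symmDiff_eq_sup]
      ext e
      simp
    rw [hsd, boundary_symmDiff, boundary_singleton h.ne, ih hp.1]
    linear_combination pt v * two_eq_zero V

theorem exists_isCycle_of_boundary_eq_zero {G : SimpleGraph V} {D : Finset (Sym2 V)}
    (hD : ∀ e ∈ D, e ∈ G.edgeSet) (h : boundary D = 0) (hne : D.Nonempty) :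
    ∃ (a : V) (C : G.Walk a a), C.IsCycle ∧ C.edges.toFinset ⊆ D := by
  obtain ⟨e, he⟩ := hne
  induction e using Sym2.ind with | _ u v
  have huv : G.Adj u v := hD _ he
  set H : SimpleGraph V := SimpleGraph.fromEdgeSet (D : Set (Sym2 V)) with hH
  have hHG : H ≤ G := by
    intro x y hxy
    rw [hH, SimpleGraph.fromEdgeSet_adj] at hxy
    exact hD _ (by simpa using hxy.1)
  have hadj : H.Adj u v := by
    rw [hH, SimpleGraph.fromEdgeSet_adj]
    exact ⟨by simpa using he, huv.ne⟩
  have hreach : (H \ SimpleGraph.fromEdgeSet {s(u, v)}).Reachable u v := by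
    by_contra hnr
    set X : Set V := {w | (H \ SimpleGraph.fromEdgeSet {s(u, v)}).Reachable u w} with hX
    have hsub : ∀ e ∈ symmDiff D {s(u, v)}, e ∈ G.edgeSet := by
      intro e he'
      rw [Finset.mem_symmDiff, Finset.mem_singleton] at he'
      rcases he' with h1 | h1
      · exact hD _ h1.1
      · rw [h1.1]
        exact huv
    obtain ⟨g, hg⟩ := inter_cutFinset_nonempty (X := X) (u := u) (v := v) hsub
      (by rw [boundary_symmDiff, h, boundary_singleton huv.ne, zero_add])
      (by
        have : u ∈ X := SimpleGraph.Reachable.refl u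
        have : v ∉ X := hnr
        tauto)
    rw [Finset.mem_inter, mem_cutFinset] at hg
    obtain ⟨hgD, hgG, x, y, rfl, hx, hy⟩ := hg
    have hxy : G.Adj x y := hgG
    have hgD' : s(x, y) ∈ D ∧ s(x, y) ≠ s(u, v) := by
      rw [Finset.mem_symmDiff, Finset.mem_singleton] at hgD
      rcases hgD with h1 | h1
      · exact h1
      · rw [h1.1] at h1
        exact absurd he h1.2
    apply hy
    have : (H \ SimpleGraph.fromEdgeSet {s(u, v)}).Adj x y := by
      rw [SimpleGraph.sdiff_adj, hH, SimpleGraph.fromEdgeSet_adj, SimpleGraph.fromEdgeSet_adj]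
      exact ⟨⟨by simpa using hgD'.1, hxy.ne⟩, fun h1 => hgD'.2 (by simpa using h1.1)⟩
    exact SimpleGraph.Reachable.trans hx this.reachable
  obtain ⟨a, C, hC, -⟩ := SimpleGraph.adj_and_reachable_delete_edges_iff_exists_cycle.1
    ⟨hadj, hreach⟩
  refine ⟨a, C.mapLe hHG, hC.mapLe hHG, fun e he' => ?_⟩
  rw [List.mem_toFinset, SimpleGraph.Walk.edges_mapLe_eq_edges] at he'
  have := C.edges_subset_edgeSet he'
  rw [hH, SimpleGraph.edgeSet_fromEdgeSet] at this
  simpa using this.1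

/-- Every edge set with all degrees even has nonnegative cost. -/
def Conservative (G : SimpleGraph V) (c : Sym2 V → ℝ) : Prop :=
  ∀ D : Finset (Sym2 V), (∀ e ∈ D, e ∈ G.edgeSet) → boundary D = 0 → 0 ≤ ∑ e ∈ D, c e

theorem conservative_of_cycles {G : SimpleGraph V} {c : Sym2 V → ℝ}
    (h : ∀ (a : V) (C : G.Walk a a), C.IsCycle → 0 ≤ ∑ e ∈ C.edges.toFinset, c e) :
    Conservative G c := by
  intro D
  induction D using Finset.strongInduction with | _ D ih
  intro hD hb
  rcases D.eq_empty_or_nonempty with rfl | hne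
  · simp
  obtain ⟨a, C, hC, hsub⟩ := exists_isCycle_of_boundary_eq_zero hD hb hne
  have hCne : C.edges.toFinset.Nonempty := by
    rw [Finset.nonempty_iff_ne_empty, Ne, List.toFinset_eq_empty_iff,
      SimpleGraph.Walk.edges_eq_nil]
    exact hC.not_nil
  have hbC : boundary C.edges.toFinset = 0 := by
    rw [boundary_edges C hC.isTrail]
    linear_combination pt a * two_eq_zero V
  have hsd : symmDiff D C.edges.toFinset = D \ C.edges.toFinset := symmDiff_of_ge hsub
  rw [← Finset.sum_sdiff hsub]
  refine add_nonneg (ih _ (Finset.sdiff_ssubset hsub hCne)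
    (fun e he => hD e (Finset.mem_sdiff.1 he).1) ?_) (h a C hC)
  rw [← hsd, boundary_symmDiff, hb, hbC, zero_add]

/-- `J` is an edge set joining `a` to `b`, of minimum cost among those joining `a` to any vertex. -/
structure IsMinJoin (G : SimpleGraph V) (c : Sym2 V → ℝ) (a b : V) (J : Finset (Sym2 V)) :
    Prop where
  subset : ∀ e ∈ J, e ∈ G.edgeSet
  boundary_eq : boundary J = pt a + pt b
  le : ∀ (K : Finset (Sym2 V)) (v : V), (∀ e ∈ K, e ∈ G.edgeSet) → boundary K = pt a + pt v →
    ∑ e ∈ J, c e ≤ ∑ e ∈ K, c e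

/-- The vertices joined to `b` by edges of cost zero. -/
def zeroClass (G : SimpleGraph V) (c : Sym2 V → ℝ) (b : V) : Set V :=
  {v | ∃ Z : Finset (Sym2 V), (∀ e ∈ Z, e ∈ G.edgeSet) ∧ (∀ e ∈ Z, c e = 0) ∧
    boundary Z = pt b + pt v}

omit [Fintype V] in
theorem mem_edgeSet_of_mem_symmDiff {G : SimpleGraph V} {J K : Finset (Sym2 V)}
    (hJ : ∀ e ∈ J, e ∈ G.edgeSet) (hK : ∀ e ∈ K, e ∈ G.edgeSet) :
    ∀ e ∈ symmDiff J K, e ∈ G.edgeSet := by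
  intro e he
  rw [Finset.mem_symmDiff] at he
  exact he.elim (fun h => hJ e h.1) (fun h => hK e h.1)

omit [Fintype V] in
theorem self_mem_zeroClass (G : SimpleGraph V) (c : Sym2 V → ℝ) (b : V) :
    b ∈ zeroClass G c b :=
  ⟨∅, by simp, by simp, by
    rw [boundary_empty]
    linear_combination (-pt b) * two_eq_zero V⟩

omit [Fintype V] in
theorem sum_symmDiff_of_eq_zero {c : Sym2 V → ℝ} {J Z : Finset (Sym2 V)}
    (hZ : ∀ e ∈ Z, c e = 0) : ∑ e ∈ symmDiff J Z, c e = ∑ e ∈ J, c e := by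
  rw [Finset.sum_symmDiff_eq, Finset.sum_eq_zero hZ,
    Finset.sum_eq_zero fun e he => hZ e (Finset.mem_inter.1 he).2]
  ring

theorem ne_zero_of_mem_cutFinset {G : SimpleGraph V} {c : Sym2 V → ℝ} {b : V} {g : Sym2 V}
    (hg : g ∈ cutFinset G (zeroClass G c b)) : c g ≠ 0 := by
  rw [mem_cutFinset] at hg
  obtain ⟨hG, u, v, rfl, ⟨Z, hZG, hZ0, hZb⟩, hv⟩ := hg
  intro h0
  refine hv ⟨symmDiff Z {s(u, v)}, mem_edgeSet_of_mem_symmDiff hZG (by simpa using hG), ?_, ?_⟩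
  · intro e he
    rw [Finset.mem_symmDiff, Finset.mem_singleton] at he
    rcases he with h | h
    · exact hZ0 e h.1
    · rw [h.1, h0]
  · rw [boundary_symmDiff, hZb, boundary_singleton (SimpleGraph.Adj.ne hG)]
    linear_combination pt u * two_eq_zero V

namespace IsMinJoin

variable {G : SimpleGraph V} {c : Sym2 V → ℝ} {a b : V} {J : Finset (Sym2 V)}

omit [Fintype V] in
theorem notMem_zeroClass (hJ : IsMinJoin G c a b J) (hc : Conservative G c)
    (hneg : ∑ e ∈ J, c e < 0) : a ∉ zeroClass G c b := by
  rintro ⟨Z, hZG, hZ0, hZb⟩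
  have := hc (symmDiff J Z) (mem_edgeSet_of_mem_symmDiff hJ.subset hZG) (by
    rw [boundary_symmDiff, hJ.boundary_eq, hZb]
    linear_combination (pt a + pt b) * two_eq_zero V)
  rw [sum_symmDiff_of_eq_zero hZ0] at this
  linarith

/-- Removing from, or adding to, a minimum join an edge of the cut around the zero class. -/
theorem le_symmDiff_singleton (hJ : IsMinJoin G c a b J) {g : Sym2 V}
    (hg : g ∈ cutFinset G (zeroClass G c b)) :
    ∑ e ∈ J, c e ≤ ∑ e ∈ symmDiff J {g}, c e := by
  rw [mem_cutFinset] at hg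
  obtain ⟨hG, u, v, rfl, ⟨Z, hZG, hZ0, hZb⟩, -⟩ := hg
  have hsub := mem_edgeSet_of_mem_symmDiff hJ.subset (K := {s(u, v)}) (by simpa using hG)
  have := hJ.le (symmDiff (symmDiff J {s(u, v)}) Z) v (mem_edgeSet_of_mem_symmDiff hsub hZG) (by
    rw [boundary_symmDiff, boundary_symmDiff, hJ.boundary_eq, hZb,
      boundary_singleton (SimpleGraph.Adj.ne hG)]
    linear_combination (pt b + pt u) * two_eq_zero V)
  rwa [sum_symmDiff_of_eq_zero hZ0] at this

theorem neg_of_mem (hJ : IsMinJoin G c a b J) {g : Sym2 V}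
    (hg : g ∈ cutFinset G (zeroClass G c b)) (hgJ : g ∈ J) : c g < 0 := by
  have h := hJ.le_symmDiff_singleton hg
  rw [Finset.sum_symmDiff_eq, Finset.inter_singleton_of_mem hgJ, Finset.sum_singleton] at h
  exact lt_of_le_of_ne (by linarith) (ne_zero_of_mem_cutFinset hg)

theorem pos_of_notMem (hJ : IsMinJoin G c a b J) {g : Sym2 V}
    (hg : g ∈ cutFinset G (zeroClass G c b)) (hgJ : g ∉ J) : 0 < c g := by
  have h := hJ.le_symmDiff_singleton hg
  rw [Finset.sum_symmDiff_eq, Finset.inter_singleton_of_notMem hgJ, Finset.sum_singleton,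
    Finset.sum_empty] at h
  exact lt_of_le_of_ne (by linarith) (ne_zero_of_mem_cutFinset hg).symm

end IsMinJoin

/-- An inclusion-minimal edge set joining `a` to the set `X` crosses the boundary of `X` once. -/
theorem exists_inter_cutFinset_eq_singleton {G : SimpleGraph V} {X : Set V} {a u : V}
    {J : Finset (Sym2 V)} (hJ : ∀ e ∈ J, e ∈ G.edgeSet) (ha : a ∉ X) (hu : u ∈ X)
    (hb : boundary J = pt a + pt u)
    (hmin : ∀ K ⊆ J, ∀ v ∈ X, boundary K = pt a + pt v → K = J) :
    ∃ f, J ∩ cutFinset G X = {f} := by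
  set A : Set V := {x | ∃ K ⊆ J, K ∩ cutFinset G X = ∅ ∧ boundary K = pt a + pt x} with hA
  have hcross : (J ∩ cutFinset G X).Nonempty := inter_cutFinset_nonempty hJ hb (by tauto)
  have hAX : ∀ x ∈ A, x ∉ X := by
    rintro x ⟨K, hKJ, hK, hKb⟩ hx
    rw [hmin K hKJ x hx hKb] at hK
    exact hcross.ne_empty hK
  have haA : a ∈ A := ⟨∅, by simp, by simp, by
    rw [boundary_empty]
    linear_combination (-pt a) * two_eq_zero V⟩
  have huA : u ∉ A := fun h => hAX u h hu
  obtain ⟨f, hf⟩ := inter_cutFinset_nonempty (X := A) hJ hb (by tauto)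
  rw [Finset.mem_inter, mem_cutFinset] at hf
  obtain ⟨hfJ, hfG, x, y, rfl, hx, hy⟩ := hf
  have hxX := hAX x hx
  obtain ⟨K, hKJ, hK, hKb⟩ := hx
  have hadj : G.Adj x y := hfG
  have hsub : symmDiff K {s(x, y)} ⊆ J := by
    intro e he
    rw [Finset.mem_symmDiff, Finset.mem_singleton] at he
    rcases he with h | h
    · exact hKJ h.1
    · rwa [h.1]
  have hbd : boundary (symmDiff K {s(x, y)}) = pt a + pt y := by
    rw [boundary_symmDiff, hKb, boundary_singleton hadj.ne]
    linear_combination pt x * two_eq_zero V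
  by_cases hyX : y ∈ X
  · refine ⟨s(x, y), ?_⟩
    have hcut : s(x, y) ∈ cutFinset G X := mk_mem_cutFinset.2 ⟨hadj, by tauto⟩
    have hJeq := hmin _ hsub y hyX hbd
    ext e
    rw [Finset.mem_inter, Finset.mem_singleton]
    constructor
    · rintro ⟨he, hec⟩
      rw [← hJeq, Finset.mem_symmDiff, Finset.mem_singleton] at he
      rcases he with h | h
      · have : e ∈ K ∩ cutFinset G X := Finset.mem_inter.2 ⟨h.1, hec⟩
        simp [hK] at this
      · exact h.1
    · rintro rfl
      exact ⟨hfJ, hcut⟩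
  · refine absurd ⟨_, hsub, ?_, hbd⟩ hy
    rw [Finset.eq_empty_iff_forall_notMem]
    intro e he
    rw [Finset.mem_inter, Finset.mem_symmDiff, Finset.mem_singleton] at he
    obtain ⟨h | h, hec⟩ := he
    · have : e ∈ K ∩ cutFinset G X := Finset.mem_inter.2 ⟨h.1, hec⟩
      simp [hK] at this
    · rw [h.1, mk_mem_cutFinset] at hec
      tauto

theorem IsMinJoin.exists_unique_neg {G : SimpleGraph V} {c : Sym2 V → ℝ} {a b : V}
    {J : Finset (Sym2 V)} (hJ : IsMinJoin G c a b J) (hc : Conservative G c)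
    (hneg : ∑ e ∈ J, c e < 0) :
    ∃ f ∈ cutFinset G (zeroClass G c b), c f < 0 ∧
      ∀ g ∈ cutFinset G (zeroClass G c b), g ≠ f → 0 < c g := by
  have ha := hJ.notMem_zeroClass hc hneg
  have hbU := self_mem_zeroClass G c b
  set U := zeroClass G c b with hU
  obtain ⟨P, hPmem, hPmin⟩ := Finset.exists_min_image
    (J.powerset.filter fun K => ∃ v ∈ U, boundary K = pt a + pt v) Finset.card
    ⟨J, by simpa using ⟨b, hbU, hJ.boundary_eq⟩⟩
  rw [Finset.mem_filter, Finset.mem_powerset] at hPmem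
  obtain ⟨hPJ, u, hu, hPb⟩ := hPmem
  obtain ⟨f, hf⟩ := exists_inter_cutFinset_eq_singleton (fun e he => hJ.subset e (hPJ he)) ha hu
    hPb (fun K hK v hv hKb => Finset.eq_of_subset_of_card_le hK
      (hPmin K (by simpa using ⟨hK.trans hPJ, v, hv, hKb⟩)))
  -- The rest of `J`, closed up by zero edges, is even, so `P` is no more expensive than `J`.
  obtain ⟨Z, hZG, hZ0, hZb⟩ := hu
  have hPG : ∀ e ∈ P, e ∈ G.edgeSet := fun e he => hJ.subset e (hPJ he)
  have hrest := hc (symmDiff (symmDiff J P) Z)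
    (mem_edgeSet_of_mem_symmDiff (mem_edgeSet_of_mem_symmDiff hJ.subset hPG) hZG) (by
      rw [boundary_symmDiff, boundary_symmDiff, hJ.boundary_eq, hPb, hZb]
      linear_combination (pt a + pt b + pt u) * two_eq_zero V)
  rw [sum_symmDiff_of_eq_zero hZ0, symmDiff_of_ge hPJ] at hrest
  have hsplit := Finset.sum_sdiff (f := c) hPJ
  have hQ : IsMinJoin G c a b (symmDiff P Z) := by
    refine ⟨mem_edgeSet_of_mem_symmDiff hPG hZG, ?_, fun K v hK hKb => ?_⟩
    · rw [boundary_symmDiff, hPb, hZb]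
      linear_combination pt u * two_eq_zero V
    · rw [sum_symmDiff_of_eq_zero hZ0]
      linarith [hJ.le K v hK hKb]
  have hmemQ : ∀ g ∈ cutFinset G U, (g ∈ symmDiff P Z ↔ g = f) := by
    intro g hg
    have hgZ : g ∉ Z := fun h => ne_zero_of_mem_cutFinset hg (hZ0 g h)
    have : g ∈ P ∩ cutFinset G U ↔ g = f := by rw [hf, Finset.mem_singleton]
    rw [Finset.mem_inter] at this
    rw [Finset.mem_symmDiff]
    tauto
  have hfcut : f ∈ cutFinset G U := by
    have : f ∈ P ∩ cutFinset G U := by simp [hf]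
    exact (Finset.mem_inter.1 this).2
  exact ⟨f, hfcut, hQ.neg_of_mem hfcut ((hmemQ f hfcut).2 rfl), fun g hg hgf =>
    hQ.pos_of_notMem hg (fun h => hgf ((hmemQ g hg).1 h))⟩

/-- The cost function with signs switched on `C`. -/
noncomputable def switch (C : Finset (Sym2 V)) (c : Sym2 V → ℝ) (e : Sym2 V) : ℝ :=
  if e ∈ C then -c e else c e

omit [Fintype V] in
theorem sum_switch (C D : Finset (Sym2 V)) (c : Sym2 V → ℝ) :
    ∑ e ∈ D, switch C c e = ∑ e ∈ symmDiff D C, c e - ∑ e ∈ C, c e := by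
  have h1 : ∑ e ∈ D, switch C c e = ∑ e ∈ D, c e - 2 * ∑ e ∈ D ∩ C, c e := by
    rw [← Finset.filter_mem_eq_inter, Finset.sum_filter, Finset.mul_sum, ← Finset.sum_sub_distrib]
    refine Finset.sum_congr rfl fun e _ => ?_
    unfold switch
    split_ifs <;> ring
  rw [h1, Finset.sum_symmDiff_eq]
  ring

omit [Fintype V] in
theorem zeroClass_switch (G : SimpleGraph V) (C : Finset (Sym2 V)) (c : Sym2 V → ℝ) (b : V) :
    zeroClass G (switch C c) b = zeroClass G c b := by
  have : ∀ e, switch C c e = 0 ↔ c e = 0 := by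
    intro e
    unfold switch
    split_ifs <;> simp
  simp only [zeroClass, this]

/-- Even sets of cost zero cross the cut around the zero class either not at all, or exactly twice
and then along its negative edge. -/
theorem card_inter_cutFinset_of_sum_eq_zero {G : SimpleGraph V} {c : Sym2 V → ℝ} {a b : V}
    {J D : Finset (Sym2 V)} (hJ : IsMinJoin G c a b J) (hc : Conservative G c)
    (hneg : ∑ e ∈ J, c e < 0) (hD : ∀ e ∈ D, e ∈ G.edgeSet) (hDb : boundary D = 0)
    (hD0 : ∑ e ∈ D, c e = 0) {f : Sym2 V} (hf : f ∈ cutFinset G (zeroClass G c b))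
    (hpos : ∀ g ∈ cutFinset G (zeroClass G c b), g ≠ f → 0 < c g) :
    (D ∩ cutFinset G (zeroClass G c b)).card = if f ∈ D then 2 else 0 := by
  have hcS : Conservative G (switch D c) := by
    intro K hK hKb
    rw [sum_switch, hD0, sub_zero]
    exact hc _ (mem_edgeSet_of_mem_symmDiff hK hD) (by rw [boundary_symmDiff, hKb, hDb, add_zero])
  have hsum : ∑ e ∈ symmDiff J D, switch D c e = ∑ e ∈ J, c e := by
    rw [sum_switch, hD0, sub_zero, symmDiff_symmDiff_cancel_right]
  have hJS : IsMinJoin G (switch D c) a b (symmDiff J D) := by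
    refine ⟨mem_edgeSet_of_mem_symmDiff hJ.subset hD, ?_, fun K v hK hKb => ?_⟩
    · rw [boundary_symmDiff, hJ.boundary_eq, hDb, add_zero]
    · rw [hsum, sum_switch, hD0, sub_zero]
      exact hJ.le _ v (mem_edgeSet_of_mem_symmDiff hK hD)
        (by rw [boundary_symmDiff, hKb, hDb, add_zero])
  obtain ⟨f', -, -, hpos'⟩ := hJS.exists_unique_neg hcS (by rw [hsum]; exact hneg)
  rw [zeroClass_switch] at hpos'
  have heven := even_card_inter_cutFinset (zeroClass G c b) hD hDb
  set B := cutFinset G (zeroClass G c b)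
  have hsub : D ∩ B ⊆ {f, f'} := by
    intro e he
    rw [Finset.mem_inter] at he
    rw [Finset.mem_insert, Finset.mem_singleton]
    by_contra! hne
    have h1 := hpos e he.2 hne.1
    have h2 := hpos' e he.2 hne.2
    rw [switch, if_pos he.1] at h2
    linarith
  have hle : (D ∩ B).card ≤ 2 := (Finset.card_le_card hsub).trans Finset.card_le_two
  have hfmem : f ∈ D ∩ B ↔ f ∈ D := by simp [hf]
  split_ifs with hfD
  · have := Finset.card_pos.2 ⟨f, hfmem.2 hfD⟩
    obtain ⟨k, hk⟩ := heven
    omega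
  · have : D ∩ B ⊆ {f'} := by
      intro e he
      have h1 := hsub he
      rw [Finset.mem_insert, Finset.mem_singleton] at h1
      rcases h1 with rfl | rfl
      · exact absurd (hfmem.1 he) hfD
      · simp
    have := Finset.card_le_card this
    rw [Finset.card_singleton] at this
    obtain ⟨k, hk⟩ := heven
    omega

/-- The cost function obtained by lowering the edges of `B` other than `f` by `ε` and raising `f`
by `ε`, for `f ∈ B`. -/
noncomputable def tilt (B : Finset (Sym2 V)) (f : Sym2 V) (c : Sym2 V → ℝ) (ε : ℝ) (e : Sym2 V) :
    ℝ :=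
  c e - ε * (if e ∈ B then 1 else 0) + 2 * ε * (if e = f then 1 else 0)

omit [Fintype V] in
theorem sum_tilt_mul (B D : Finset (Sym2 V)) (f : Sym2 V) (c x : Sym2 V → ℝ) (ε : ℝ) :
    ∑ e ∈ D, tilt B f c ε e * x e = ∑ e ∈ D, c e * x e - ε * ∑ e ∈ D ∩ B, x e +
      2 * ε * (if f ∈ D then x f else 0) := by
  rw [← Finset.filter_mem_eq_inter, Finset.sum_filter, Finset.mul_sum, ← Finset.sum_sub_distrib,
    ← Finset.sum_ite_eq' D f x, Finset.mul_sum, ← Finset.sum_add_distrib]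
  refine Finset.sum_congr rfl fun e _ => ?_
  unfold tilt
  split_ifs <;> ring

omit [Fintype V] in
theorem sum_tilt (B D : Finset (Sym2 V)) (f : Sym2 V) (c : Sym2 V → ℝ) (ε : ℝ) :
    ∑ e ∈ D, tilt B f c ε e = ∑ e ∈ D, c e - ε * (D ∩ B).card +
      2 * ε * (if f ∈ D then 1 else 0) := by
  simpa using sum_tilt_mul B D f c (fun _ => 1) ε

omit [Fintype V] in
theorem abs_tilt {B : Finset (Sym2 V)} {f : Sym2 V} {c : Sym2 V → ℝ} {ε : ℝ} (hfB : f ∈ B)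
    (hf : c f < 0) (hpos : ∀ g ∈ B, g ≠ f → 0 < c g) {e : Sym2 V} (he : e ∈ B)
    (hε : ε ≤ |c e|) : |tilt B f c ε e| = |c e| - ε := by
  unfold tilt
  by_cases hef : e = f
  · subst hef
    rw [abs_of_neg hf] at hε ⊢
    simp only [he, if_true]
    rw [abs_of_nonpos (by linarith)]
    ring
  · have := hpos e he hef
    rw [abs_of_pos this] at hε ⊢
    simp only [he, hef, if_true, if_false]
    rw [abs_of_nonneg (by linarith)]
    ring

theorem exists_isMinJoin {G : SimpleGraph V} {c : Sym2 V → ℝ} {e : Sym2 V} (he : e ∈ G.edgeSet)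
    (hneg : c e < 0) : ∃ a b J, IsMinJoin G c a b J ∧ ∑ e ∈ J, c e < 0 := by
  induction e using Sym2.ind with | _ u v
  have huv : G.Adj u v := he
  obtain ⟨J, hJ, hmin⟩ := Finset.exists_min_image
    (Finset.univ.filter fun K : Finset (Sym2 V) => (∀ e ∈ K, e ∈ G.edgeSet) ∧
      ∃ w, boundary K = pt u + pt w) (fun K => ∑ e ∈ K, c e)
    ⟨{s(u, v)}, by simpa using ⟨huv, v, boundary_singleton huv.ne⟩⟩
  simp only [Finset.mem_filter, Finset.mem_univ, true_and] at hJ hmin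
  obtain ⟨hJG, b, hb⟩ := hJ
  refine ⟨u, b, J, ⟨hJG, hb, fun K w hK hw => hmin K ⟨hK, w, hw⟩⟩, ?_⟩
  have := hmin {s(u, v)} ⟨by simpa using huv, v, boundary_singleton huv.ne⟩
  rw [Finset.sum_singleton] at this
  linarith

open Filter Topology in
/-- A conservative cost function with a negative edge dominates, on every vector satisfying the cut
inequalities, a conservative cost function of smaller norm. -/
theorem exists_conservative_sum_abs_lt {G : SimpleGraph V} {c x : Sym2 V → ℝ}
    (hc : Conservative G c)
    (hx : ∀ X : Set V, X.Nonempty → X ≠ Set.univ →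
      ∀ e ∈ cutFinset G X, x e - ∑ f ∈ (cutFinset G X).erase e, x f ≤ 0)
    {e₀ : Sym2 V} (he₀ : e₀ ∈ G.edgeSet) (hneg : c e₀ < 0) :
    ∃ c' : Sym2 V → ℝ, Conservative G c' ∧
      ∑ e with e ∈ G.edgeSet, c' e * x e ≤ ∑ e with e ∈ G.edgeSet, c e * x e ∧
      ∑ e, |c' e| < ∑ e, |c e| := by
  obtain ⟨a, b, J, hJ, hJneg⟩ := exists_isMinJoin he₀ hneg
  obtain ⟨f, hfB, hf, hpos⟩ := hJ.exists_unique_neg hc hJneg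
  have ha := hJ.notMem_zeroClass hc hJneg
  have hcut := hx _ ⟨b, self_mem_zeroClass G c b⟩ (fun h => ha (h ▸ Set.mem_univ a)) f hfB
  have hcard := fun D hD hDb hD0 =>
    card_inter_cutFinset_of_sum_eq_zero (D := D) hJ hc hJneg hD hDb hD0 hfB hpos
  have hBG : ∀ e ∈ cutFinset G (zeroClass G c b), e ∈ G.edgeSet :=
    fun e he => (mem_cutFinset.1 he).1
  have hne : ∀ e ∈ cutFinset G (zeroClass G c b), c e ≠ 0 := fun e he =>
    ne_zero_of_mem_cutFinset he
  set B := cutFinset G (zeroClass G c b)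
  have hε₁ : ∀ᶠ ε : ℝ in 𝓝[>] 0, ∀ D : Finset (Sym2 V), 0 < ∑ e ∈ D, c e →
      ε * (D ∩ B).card ≤ ∑ e ∈ D, c e := by
    rw [eventually_all]
    intro D
    by_cases hD : 0 < ∑ e ∈ D, c e
    · have : Tendsto (fun ε : ℝ => ε * ((D ∩ B).card : ℝ)) (𝓝[>] 0) (𝓝 0) := by
        have : Continuous fun ε : ℝ => ε * ((D ∩ B).card : ℝ) := by fun_prop
        simpa using (this.tendsto 0).mono_left nhdsWithin_le_nhds
      filter_upwards [this.eventually_lt_const hD] with ε hε _ using hε.le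
    · exact Eventually.of_forall fun ε h => absurd h hD
  have hε₂ : ∀ᶠ ε : ℝ in 𝓝[>] 0, ∀ e : Sym2 V, e ∈ B → ε ≤ |c e| := by
    rw [eventually_all]
    intro e
    by_cases he : e ∈ B
    · have : Tendsto (fun ε : ℝ => ε) (𝓝[>] 0) (𝓝 0) := nhdsWithin_le_nhds
      filter_upwards [this.eventually_lt_const (abs_pos.2 (hne e he))] with ε hε _ using hε.le
    · exact Eventually.of_forall fun ε h => absurd h he
  obtain ⟨ε, ⟨hε₁, hε₂⟩, hε⟩ := ((hε₁.and hε₂).and self_mem_nhdsWithin).exists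
  refine ⟨tilt B f c ε, fun D hD hDb => ?_, ?_, ?_⟩
  · rw [sum_tilt]
    rcases (hc D hD hDb).eq_or_lt with h0 | h0
    · rw [hcard D hD hDb h0.symm, ← h0]
      split_ifs <;> simp [mul_comm]
    · have := hε₁ D h0
      have : 0 ≤ 2 * ε * (if f ∈ D then 1 else 0) := by split_ifs <;> linarith
      linarith
  · have hinter : (Finset.univ.filter (fun e => e ∈ G.edgeSet)) ∩ B = B :=
      Finset.inter_eq_right.2 fun e he => by simpa using hBG e he
    rw [sum_tilt_mul, hinter, if_pos (by simpa using hBG f hfB), ← Finset.add_sum_erase B x hfB]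
    nlinarith
  · refine Finset.sum_lt_sum (fun e _ => ?_) ⟨f, Finset.mem_univ f, ?_⟩
    · by_cases he : e ∈ B
      · rw [abs_tilt hfB hf hpos he (hε₂ e he)]
        linarith
      · have : e ≠ f := fun h => he (h ▸ hfB)
        simp [tilt, he, this]
    · rw [abs_tilt hfB hf hpos hfB (hε₂ f hfB)]
      linarith

omit [Fintype V] in
theorem isClosed_conservative (G : SimpleGraph V) : IsClosed {c | Conservative G c} := by
  simp only [Conservative, Set.ofPred_forall]
  exact isClosed_iInter fun D => isClosed_iInter fun _ => isClosed_iInter fun _ =>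
    isClosed_le continuous_const (by fun_prop)

theorem Conservative.sum_mul_nonneg {G : SimpleGraph V} {c x : Sym2 V → ℝ}
    (hc : Conservative G c) (hx0 : ∀ e, 0 ≤ x e)
    (hx : ∀ X : Set V, X.Nonempty → X ≠ Set.univ →
      ∀ e ∈ cutFinset G X, x e - ∑ f ∈ (cutFinset G X).erase e, x f ≤ 0) :
    0 ≤ ∑ e with e ∈ G.edgeSet, c e * x e := by
  by_contra! hneg
  set S : Set (Sym2 V → ℝ) := {d | Conservative G d} ∩
    {d | ∑ e with e ∈ G.edgeSet, d e * x e ≤ ∑ e with e ∈ G.edgeSet, c e * x e} ∩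
    {d | ∑ e, |d e| ≤ ∑ e, |c e|} with hS
  have hclosed : IsClosed S :=
    ((isClosed_conservative G).inter (isClosed_le (by fun_prop) continuous_const)).inter
      (isClosed_le (by fun_prop) continuous_const)
  have hcompact : IsCompact S := by
    refine (isCompact_closedBall (0 : Sym2 V → ℝ) (∑ e, |c e|)).of_isClosed_subset hclosed ?_
    rintro d ⟨-, hd⟩
    rw [mem_closedBall_zero_iff, pi_norm_le_iff_of_nonneg (by positivity)]
    exact fun e => (Finset.single_le_sum (f := fun e => |d e|) (fun _ _ => abs_nonneg _)
      (Finset.mem_univ e)).trans hd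
  obtain ⟨d, ⟨⟨hd, hdx⟩, hdc⟩, hmin⟩ := hcompact.exists_isMinOn
    ⟨c, ⟨hc, le_refl (∑ e with e ∈ G.edgeSet, c e * x e)⟩,
      le_refl (∑ e, |c e|)⟩
    (f := fun d => ∑ e, |d e|) (by fun_prop)
  simp only [Set.mem_ofPred_eq] at hd hdx hdc
  obtain ⟨e₀, he₀, hlt⟩ := Finset.exists_lt_of_sum_lt
    (s := Finset.univ.filter fun e => e ∈ G.edgeSet) (f := fun e => d e * x e) (g := fun _ => 0)
    (by simpa using hdx.trans_lt hneg)
  obtain ⟨d', hd', hd'x, hd'lt⟩ := exists_conservative_sum_abs_lt hd hx (by simpa using he₀)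
    (neg_of_mul_neg_left hlt (hx0 e₀))
  exact hd'lt.not_ge (hmin ⟨⟨hd', hd'x.trans hdx⟩, hd'lt.le.trans hdc⟩)

/-- The indicator of an edge set with all degrees even satisfies the cut inequalities. -/
theorem indicator_sub_sum_le_zero {G : SimpleGraph V} {D : Finset (Sym2 V)}
    (hD : ∀ e ∈ D, e ∈ G.edgeSet) (hDb : boundary D = 0) (X : Set V) {e : Sym2 V}
    (he : e ∈ cutFinset G X) :
    (if e ∈ D then (1 : ℝ) else 0) -
      ∑ f ∈ (cutFinset G X).erase e, (if f ∈ D then (1 : ℝ) else 0) ≤ 0 := by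
  have hnonneg : ∀ f ∈ (cutFinset G X).erase e, (0 : ℝ) ≤ if f ∈ D then 1 else 0 :=
    fun f _ => by split_ifs <;> norm_num
  by_cases heD : e ∈ D
  · obtain ⟨k, hk⟩ := even_card_inter_cutFinset X hD hDb
    have hpos := Finset.card_pos.2 ⟨e, Finset.mem_inter.2 ⟨heD, he⟩⟩
    obtain ⟨f, hf, hfe⟩ := Finset.exists_mem_ne (by omega : 1 < (D ∩ cutFinset G X).card) e
    rw [Finset.mem_inter] at hf
    have := Finset.single_le_sum hnonneg (Finset.mem_erase.2 ⟨hfe, hf.2⟩)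
    rw [if_pos hf.1] at this
    rw [if_pos heD]
    linarith
  · rw [if_neg heD]
    linarith [Finset.sum_nonneg hnonneg]

end SignedGraph

open SignedGraph in
/-- There exists `x ∈ ℝ^E` with `x ≥ 0`, satisfying
`x e − x(B \ {e}) ≤ 0` for every cut `B` and every edge `e ∈ B`, and with
`∑_{e ∈ E} c e * x e < 0`, iff `G` contains a simple cycle of negative `c`-cost. -/
theorem negative_lp_solution_iff_negative_cycle
    {V : Type*} [Fintype V] [DecidableEq V] (G : SimpleGraph V) (c : Sym2 V → ℝ) :
    (∃ x : Sym2 V → ℝ,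
        (∀ e, 0 ≤ x e) ∧ (∀ e, e ∉ G.edgeSet → x e = 0) ∧
        (∀ X : Set V, X.Nonempty → X ≠ Set.univ →
          ∀ e ∈ cutFinset G X, x e - ∑ f ∈ (cutFinset G X).erase e, x f ≤ 0) ∧
        (∑ e ∈ Finset.univ.filter (fun e => e ∈ G.edgeSet), c e * x e) < 0) ↔
    (∃ (a : V) (C : G.Walk a a), C.IsCycle ∧ (∑ e ∈ C.edges.toFinset, c e) < 0) := by
  constructor
  · rintro ⟨x, hx0, -, hx, hneg⟩
    by_contra! h
    exact hneg.not_ge ((conservative_of_cycles h).sum_mul_nonneg hx0 hx)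
  · rintro ⟨a, C, hC, hneg⟩
    have hsub : ∀ e ∈ C.edges.toFinset, e ∈ G.edgeSet := fun e he =>
      C.edges_subset_edgeSet (List.mem_toFinset.1 he)
    have hb : boundary C.edges.toFinset = 0 := by
      rw [boundary_edges C hC.isTrail]
      linear_combination pt a * two_eq_zero V
    refine ⟨fun e => if e ∈ C.edges.toFinset then 1 else 0, fun e => ?_, fun e he => ?_,
      fun X _ _ e he => indicator_sub_sum_le_zero hsub hb X he, ?_⟩
    · dsimp only
      split_ifs <;> norm_num
    · exact if_neg fun h => he (hsub e h)
    · have hinter : (Finset.univ.filter fun e => e ∈ G.edgeSet) ∩ C.edges.toFinset =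
          C.edges.toFinset := Finset.inter_eq_right.2 fun e he => by simpa using hsub e he
      simp only [mul_ite, mul_one, mul_zero]
      rwa [← Finset.sum_filter, Finset.filter_mem_eq_inter, hinter]
end

section
/- There exists a 2-matching game instance (G,b,w), a core allocation p, distinct vertices s,t, and a walk W = (s, x_1, x_2, x_3, t) of length 4 in G whose internal vertices all have capacity 2, such that the total edge weight of W counted with multiplicity exceeds the total allocation of its vertices counted with multiplicity: Σ_{r=0}^{3} w_{x_r x_{r+1}} > p_s + p_{x_1} + p_{x_2} + p_{x_3} + p_t (with x_0 = s, x_4 = t). Concretely, take G on {s,t,u,v,w} with edges su, tu, uv, vw, weights w_{su} = w_{tu} = w_{vw} = 1, w_{uv} = 10, capacities b_s = b_t = b_w = 1, b_u = b_v = 2, the core allocation p_s = p_t = p_w = 0, p_u = 2, p_v = 10, and the walk (s, u, v, u, t), for which the edge weights sum to 22 while the vertex allocations sum to 14. (This shows that a shortest-path computation in a layered auxiliary graph that allows repeated vertices can report a negative value even for a core allocation.) -/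
open Classical

/-- The value function of the `b`-matching game: `bMatchValue G b w S` is the maximum
total `w`-weight of a `b`-matching of `G` all of whose edges have both endpoints in `S`. -/
noncomputable def bMatchValue {V : Type*} [Fintype V] (G : SimpleGraph V) (b : V → ℕ)
    (w : Sym2 V → ℝ) (S : Finset V) : ℝ :=
  sSup { x : ℝ | ∃ M : Finset (Sym2 V),
    (∀ e ∈ M, e ∈ G.edgeSet) ∧
    (∀ e ∈ M, ∀ v ∈ e, v ∈ S) ∧
    (∀ v : V, (M.filter (fun e => v ∈ e)).card ≤ b v) ∧
    x = ∑ e ∈ M, w e }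

/-- `p` is a core allocation of the cooperative game with value function `ν`. -/
def InCore {V : Type*} [Fintype V] (ν : Finset V → ℝ) (p : V → ℝ) : Prop :=
  (∑ v, p v) = ν Finset.univ ∧
  ∀ S : Finset V, S ⊂ Finset.univ → ν S ≤ ∑ v ∈ S, p v

/-- The value of a coalition is bounded by any common upper bound of the weights of the
`b`-matchings it contains. -/
theorem bMatchValue_le {V : Type*} [Fintype V] {G : SimpleGraph V} {b : V → ℕ}
    {w : Sym2 V → ℝ} {S : Finset V} {c : ℝ}
    (h : ∀ M : Finset (Sym2 V), (∀ e ∈ M, e ∈ G.edgeSet) → (∀ e ∈ M, ∀ v ∈ e, v ∈ S) →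
      (∀ v : V, (M.filter (fun e => v ∈ e)).card ≤ b v) → ∑ e ∈ M, w e ≤ c) :
    bMatchValue G b w S ≤ c := by
  refine csSup_le ⟨0, ∅, by simp⟩ ?_
  rintro x ⟨M, hG, hS, hb, rfl⟩
  exact h M hG hS hb

/-- The weight of a `b`-matching inside a coalition is at most the value of the coalition. -/
theorem le_bMatchValue {V : Type*} [Fintype V] {G : SimpleGraph V} {b : V → ℕ}
    {w : Sym2 V → ℝ} {S : Finset V} (M : Finset (Sym2 V)) (hG : ∀ e ∈ M, e ∈ G.edgeSet)
    (hS : ∀ e ∈ M, ∀ v ∈ e, v ∈ S)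
    (hb : ∀ v : V, (M.filter (fun e => v ∈ e)).card ≤ b v) :
    ∑ e ∈ M, w e ≤ bMatchValue G b w S := by
  refine le_csSup ?_ ⟨M, hG, hS, hb, rfl⟩
  refine ((Set.finite_range fun N : Finset (Sym2 V) => ∑ e ∈ N, w e).subset ?_).bddAbove
  rintro x ⟨N, -, -, -, rfl⟩
  exact ⟨N, rfl⟩

/-- The edges `su`, `tu`, `uv`, `vw` of the example, with `s, t, u, v, w = 0, 1, 2, 3, 4`. -/
def exampleEdges : Finset (Sym2 (Fin 5)) := {s(0, 2), s(1, 2), s(2, 3), s(3, 4)}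

/-- The graph of the example. -/
def exampleGraph : SimpleGraph (Fin 5) := SimpleGraph.fromEdgeSet exampleEdges

/-- The capacities of the example. -/
def exampleCapacity : Fin 5 → ℕ := ![1, 1, 2, 2, 1]

/-- The edge weights of the example. -/
noncomputable def exampleWeight (e : Sym2 (Fin 5)) : ℝ := if e = s(2, 3) then 10 else 1

/-- The core allocation of the example. -/
def exampleAllocation : Fin 5 → ℝ := ![0, 0, 2, 10, 0]

theorem bMatchValue_le_exampleAllocation (S : Finset (Fin 5)) :
    bMatchValue exampleGraph exampleCapacity exampleWeight S ≤
      ∑ v ∈ S, exampleAllocation v := by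
  refine bMatchValue_le fun M hG hS hb => ?_
  have hM : M ⊆ exampleEdges := fun e he => by
    have := hG e he
    simp only [exampleGraph, SimpleGraph.edgeSet_fromEdgeSet] at this
    exact this.1
  have hsum : ∑ e ∈ M, exampleWeight e =
      ∑ e ∈ exampleEdges, if e ∈ M then exampleWeight e else 0 := by
    rw [Finset.sum_ite_mem, Finset.inter_eq_right.mpr hM]
  have hall : ∑ v ∈ S, exampleAllocation v =
      ∑ v, if v ∈ S then exampleAllocation v else 0 := by
    rw [Finset.sum_ite_mem, Finset.univ_inter]
  have hu : ¬ (s(0, 2) ∈ M ∧ s(1, 2) ∈ M ∧ s(2, 3) ∈ M) := by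
    rintro ⟨h₀, h₁, h₂⟩
    have hcard : ({s(0, 2), s(1, 2), s(2, 3)} : Finset (Sym2 (Fin 5))).card ≤
        exampleCapacity 2 := by
      refine (Finset.card_le_card ?_).trans (hb 2)
      simp [Finset.insert_subset_iff, h₀, h₁, h₂]
    simp [exampleCapacity] at hcard
  have hsu : s(0, 2) ∈ M → 2 ∈ S := fun h => hS _ h 2 (by simp)
  have htu : s(1, 2) ∈ M → 2 ∈ S := fun h => hS _ h 2 (by simp)
  have huv : s(2, 3) ∈ M → 2 ∈ S := fun h => hS _ h 2 (by simp)
  have huv' : s(2, 3) ∈ M → 3 ∈ S := fun h => hS _ h 3 (by simp)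
  have hvw : s(3, 4) ∈ M → 3 ∈ S := fun h => hS _ h 3 (by simp)
  rw [hsum, hall]
  simp only [exampleEdges, exampleWeight, exampleAllocation, Fin.sum_univ_five]
  by_cases h₀ : s(0, 2) ∈ M <;> by_cases h₁ : s(1, 2) ∈ M <;> by_cases h₂ : s(2, 3) ∈ M <;>
    by_cases h₃ : s(3, 4) ∈ M <;> by_cases h₄ : 2 ∈ S <;> by_cases h₅ : 3 ∈ S <;>
    simp_all <;> norm_num

theorem exampleAllocation_sum : ∑ v, exampleAllocation v = 12 := by
  simp [exampleAllocation, Fin.sum_univ_five]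
  norm_num

theorem exampleAllocation_inCore :
    InCore (bMatchValue exampleGraph exampleCapacity exampleWeight) exampleAllocation := by
  refine ⟨le_antisymm ?_ (bMatchValue_le_exampleAllocation _),
    fun S _ => bMatchValue_le_exampleAllocation S⟩
  have hmatch := le_bMatchValue (G := exampleGraph) (b := exampleCapacity)
    (w := exampleWeight) (S := Finset.univ) {s(0, 2), s(2, 3), s(3, 4)}
    (by simp [exampleGraph, exampleEdges]) (by simp)
    (by
      intro v
      fin_cases v <;> simp [exampleCapacity, Finset.filter_insert, Finset.filter_singleton])
  have hweight : ∑ e ∈ ({s(0, 2), s(2, 3), s(3, 4)} : Finset (Sym2 (Fin 5))),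
      exampleWeight e = 12 := by
    simp [exampleWeight]
    norm_num
  rw [exampleAllocation_sum, ← hweight]
  exact hmatch

/-- There exist a 2-matching game instance `(G, b, w)` (on a finite
vertex set), a core allocation `p`, distinct vertices `s, t`, and a walk
`(s, x₁, x₂, x₃, t)` of length 4 in `G` whose internal vertices all have capacity 2, such
that the total edge weight of the walk, counted with multiplicity, exceeds the total
allocation of its vertices, counted with multiplicity. -/
theorem exists_core_allocation_with_negative_walk :
    ∃ (n : ℕ) (G : SimpleGraph (Fin n)) (b : Fin n → ℕ) (w : Sym2 (Fin n) → ℝ)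
      (p : Fin n → ℝ) (s x₁ x₂ x₃ t : Fin n),
      (∀ v, b v ≤ 2) ∧
      (∀ e ∈ G.edgeSet, 0 ≤ w e) ∧
      InCore (bMatchValue G b w) p ∧
      s ≠ t ∧
      b x₁ = 2 ∧ b x₂ = 2 ∧ b x₃ = 2 ∧
      G.Adj s x₁ ∧ G.Adj x₁ x₂ ∧ G.Adj x₂ x₃ ∧ G.Adj x₃ t ∧
      p s + p x₁ + p x₂ + p x₃ + p t <
        w s(s, x₁) + w s(x₁, x₂) + w s(x₂, x₃) + w s(x₃, t) := by
  refine ⟨5, exampleGraph, exampleCapacity, exampleWeight, exampleAllocation, 0, 2, 3, 2, 1,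
    ?_, ?_, exampleAllocation_inCore, by decide, rfl, rfl, rfl, ?_, ?_, ?_, ?_, ?_⟩
  · intro v
    fin_cases v <;> simp [exampleCapacity]
  · intro e _
    unfold exampleWeight
    split_ifs <;> norm_num
  iterate 4 · simp [exampleGraph, exampleEdges]
  simp [exampleWeight, exampleAllocation]
  norm_num
end

section
/- Let G = (V,E) be a finite simple graph with edge weights p', w ∈ ℝ^E_{≥0}, and define c ∈ ℝ^E by c_e = p'_e − w_e. Then the following are equivalent: (a) every simple cycle C of G satisfies Σ_{e ∈ C} w_e ≤ Σ_{e ∈ C} p'_e; (b) G contains no simple cycle C with Σ_{e ∈ C} c_e < 0; (c) there is no x ∈ ℝ^E with x ≥ 0, x_e ≤ Σ_{f ∈ B\{e}} x_f for every cut B of G and every e ∈ B, and Σ_{e ∈ E} c_e x_e < 0. -/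
open Classical

/-- The slack of the inequality `x e ≤ x(B \ {e})` for the cut `B` separating the fibres of `h`,
in the multigraph whose edge `f` joins `s f` to `t f`; it is `0` if `e` is not in `B`. -/
noncomputable def cutSlack {α ι : Type*} [Fintype ι] (s t : ι → α) (h : α → ZMod 2) (e : ι)
    (x : ι → ℝ) : ℝ :=
  if h (s e) = h (t e) then 0 else (∑ f, if h (s f) = h (t f) then 0 else x f) - 2 * x e

/-- The nonnegative vectors satisfying all cut inequalities. -/
def InCutCone {α ι : Type*} [Fintype ι] (s t : ι → α) (x : ι → ℝ) : Prop :=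
  (∀ e, 0 ≤ x e) ∧ ∀ h e, 0 ≤ cutSlack s t h e x

/-- Edge sets meeting every cut in an even number of edges. -/
def IsEvenEdgeSet {α ι : Type*} (s t : ι → α) (F : Finset ι) : Prop :=
  ∀ h : α → ZMod 2, ∑ e ∈ F, (h (s e) + h (t e)) = 0

/-- Every even edge set inside the support of `x` has nonnegative cost. -/
def IsConservativeOn {α ι : Type*} (s t : ι → α) (x c : ι → ℝ) : Prop :=
  ∀ F : Finset ι, IsEvenEdgeSet s t F → (∀ e ∈ F, x e ≠ 0) → 0 ≤ ∑ e ∈ F, c e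

/-- The endpoints of the non-loop edges in the support of `x`. -/
noncomputable def supportVerts {α ι : Type*} [Fintype α] (s t : ι → α) (x : ι → ℝ) : Finset α :=
  Finset.univ.filter fun v => ∃ e, x e ≠ 0 ∧ s e ≠ t e ∧ (s e = v ∨ t e = v)

/-- The number of strict inequalities among those defining the cut cone. -/
noncomputable def strictCount {α ι : Type*} [Fintype α] [Fintype ι] (s t : ι → α) (x : ι → ℝ) :
    ℕ :=
  (Finset.univ.filter fun i : ι ⊕ (α → ZMod 2) × ι =>
    Sum.elim x (fun p => cutSlack s t p.1 p.2 x) i ≠ 0).card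

section Cone

variable {α ι : Type*} {s t : ι → α} {c x : ι → ℝ}

lemma ZMod.two_add_eq_ite (a b : ZMod 2) : a + b = if a = b then 0 else 1 := by
  revert a b; decide

lemma sum_eq_sum_univ_ite [Fintype ι] {β : Type*} [AddCommMonoid β] (F : Finset ι) (f : ι → β) :
    ∑ e ∈ F, f e = ∑ e, if e ∈ F then f e else 0 := by
  simp

lemma cutSlack_add_smul [Fintype ι] (s t : ι → α) (h : α → ZMod 2) (e : ι) (x z : ι → ℝ) (r : ℝ) :
    cutSlack s t h e (fun f => x f + r * z f) =
      cutSlack s t h e x + r * cutSlack s t h e z := by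
  unfold cutSlack
  split_ifs with he
  · simp
  · have : (∑ f, if h (s f) = h (t f) then (0 : ℝ) else x f + r * z f) =
        (∑ f, if h (s f) = h (t f) then 0 else x f) +
          r * ∑ f, if h (s f) = h (t f) then 0 else z f := by
      rw [Finset.mul_sum, ← Finset.sum_add_distrib]
      exact Finset.sum_congr rfl fun f _ => by split_ifs <;> simp
    rw [this]; ring

lemma cutSlack_of_ne [Fintype ι] {h : α → ZMod 2} {e : ι} (he : h (s e) ≠ h (t e)) (x : ι → ℝ) :
    cutSlack s t h e x = (∑ f, if h (s f) = h (t f) then 0 else x f) - 2 * x e := if_neg he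

lemma cutSlack_of_eq [Fintype ι] {h : α → ZMod 2} {e : ι} (he : h (s e) = h (t e)) (x : ι → ℝ) :
    cutSlack s t h e x = 0 := if_pos he

lemma InCutCone.comp [Fintype ι] (hx : InCutCone s t x) (r : α → α) :
    InCutCone (r ∘ s) (r ∘ t) x :=
  ⟨hx.1, fun h e => hx.2 (h ∘ r) e⟩

lemma exists_step_to_boundary {κ : Type*} [Fintype κ] (a b : κ → ℝ) (ha : ∀ i, 0 ≤ a i)
    (hab : ∀ i, a i = 0 → b i = 0) (hb : ∃ i, b i < 0) :
    ∃ r : ℝ, 0 ≤ r ∧ (∀ i, 0 ≤ a i + r * b i) ∧ ∃ i, a i ≠ 0 ∧ a i + r * b i = 0 := by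
  obtain ⟨j, hj⟩ := hb
  obtain ⟨i, hi, hmin⟩ := Finset.exists_min_image (Finset.univ.filter fun i => b i < 0)
    (fun i => a i / -b i) ⟨j, by simpa using hj⟩
  simp only [Finset.mem_filter, Finset.mem_univ, true_and] at hi hmin
  refine ⟨a i / -b i, div_nonneg (ha i) (by linarith), fun k => ?_, i, fun h => ?_, ?_⟩
  · rcases lt_or_ge (b k) 0 with hk | hk
    · have := mul_le_mul_of_nonneg_right (hmin k hk) (show 0 ≤ -b k by linarith)
      rw [div_mul_cancel₀ _ (by linarith : -b k ≠ 0)] at this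
      linarith
    · have := mul_nonneg (div_nonneg (ha i) (show 0 ≤ -b i by linarith)) hk
      linarith [ha k]
  · exact hi.ne (hab i h)
  · have : b i ≠ 0 := hi.ne
    field_simp
    ring

lemma InCutCone.exists_strictCount_lt [Fintype α] [Fintype ι] (hx : InCutCone s t x) {z : ι → ℝ}
    (hz : ∀ e, x e = 0 → z e = 0)
    (hs : ∀ h e, x e ≠ 0 → cutSlack s t h e x = 0 → cutSlack s t h e z = 0)
    (hc : ∑ e, c e * z e ≤ 0) (hneg : ∃ e, z e < 0) :
    ∃ x', InCutCone s t x' ∧ (∀ e, x e = 0 → x' e = 0) ∧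
      ∑ e, c e * x' e ≤ ∑ e, c e * x e ∧ strictCount s t x' < strictCount s t x := by
  have hs' : ∀ h e, cutSlack s t h e x = 0 → cutSlack s t h e z = 0 := by
    intro h e he
    by_cases hxe : x e = 0
    · by_cases hh : h (s e) = h (t e)
      · exact cutSlack_of_eq hh z
      · rw [cutSlack_of_ne hh, hxe, mul_zero, sub_zero,
          Finset.sum_eq_zero_iff_of_nonneg
            (fun f _ => by split_ifs; exacts [le_rfl, hx.1 f])] at he
        rw [cutSlack_of_ne hh, hz e hxe, mul_zero, sub_zero]
        refine Finset.sum_eq_zero fun f hf => ?_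
        have := he f hf
        split_ifs at this ⊢
        exacts [rfl, hz f this]
    · exact hs h e hxe he
  obtain ⟨e₀, he₀⟩ := hneg
  obtain ⟨r, hr, hall, i, hi, hi0⟩ := exists_step_to_boundary
    (Sum.elim x (fun p : (α → ZMod 2) × ι => cutSlack s t p.1 p.2 x))
    (Sum.elim z (fun p : (α → ZMod 2) × ι => cutSlack s t p.1 p.2 z))
    (by rintro (e | p); exacts [hx.1 e, hx.2 p.1 p.2])
    (by rintro (e | p); exacts [hz e, hs' p.1 p.2]) ⟨Sum.inl e₀, he₀⟩
  have hval : ∀ i, Sum.elim (fun f => x f + r * z f)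
      (fun p : (α → ZMod 2) × ι => cutSlack s t p.1 p.2 (fun f => x f + r * z f)) i =
      Sum.elim x (fun p : (α → ZMod 2) × ι => cutSlack s t p.1 p.2 x) i +
        r * Sum.elim z (fun p : (α → ZMod 2) × ι => cutSlack s t p.1 p.2 z) i := by
    rintro (e | p)
    exacts [rfl, cutSlack_add_smul _ _ _ _ _ _ _]
  refine ⟨fun f => x f + r * z f, ⟨fun e => hall (Sum.inl e), fun h e => ?_⟩,
    fun e he => by simp [he, hz e he], ?_, ?_⟩
  · rw [cutSlack_add_smul]; exact hall (Sum.inr (h, e))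
  · have : ∑ e, c e * (x e + r * z e) = ∑ e, c e * x e + r * ∑ e, c e * z e := by
      rw [Finset.mul_sum, ← Finset.sum_add_distrib]
      exact Finset.sum_congr rfl fun e _ => by ring
    rw [this]
    nlinarith
  · refine Finset.card_lt_card ⟨fun k => ?_, fun hsub => ?_⟩
    · simp only [Finset.mem_filter, Finset.mem_univ, true_and, hval]
      refine fun hk h0 => hk ?_
      have : Sum.elim z (fun p : (α → ZMod 2) × ι => cutSlack s t p.1 p.2 z) k = 0 := by
        rcases k with e | p
        exacts [hz e h0, hs' p.1 p.2 h0]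
      rw [h0, this]; simp
    · have := hsub (show i ∈ _ by simpa using hi)
      simp only [Finset.mem_filter, Finset.mem_univ, true_and, hval] at this
      exact this hi0

lemma card_supportVerts_comp_lt [Fintype α] (r : α → α) {u v : α} (hu : u ∈ supportVerts s t x)
    (hv : v ∈ supportVerts s t x) (huv : u ≠ v) (hr : r u = r v) :
    (supportVerts (r ∘ s) (r ∘ t) x).card < (supportVerts s t x).card := by
  have hsub : supportVerts (r ∘ s) (r ∘ t) x ⊆ (supportVerts s t x).image r := by
    intro w hw
    simp only [supportVerts, Finset.mem_filter, Finset.mem_univ, true_and, Finset.mem_image,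
      Function.comp] at hw ⊢
    obtain ⟨e, he, hne, rfl | rfl⟩ := hw
    · exact ⟨s e, ⟨e, he, fun h => hne (by rw [h]), Or.inl rfl⟩, rfl⟩
    · exact ⟨t e, ⟨e, he, fun h => hne (by rw [h]), Or.inr rfl⟩, rfl⟩
  refine (Finset.card_le_card hsub).trans_lt (lt_of_le_of_ne Finset.card_image_le fun h => ?_)
  exact huv (Finset.card_image_iff.1 h hu hv hr)

lemma supportVerts_subset [Fintype α] {x' : ι → ℝ} (h : ∀ e, x e = 0 → x' e = 0) :
    supportVerts s t x' ⊆ supportVerts s t x := by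
  intro v hv
  simp only [supportVerts, Finset.mem_filter, Finset.mem_univ, true_and] at hv ⊢
  obtain ⟨e, he, h'⟩ := hv
  exact ⟨e, fun h0 => he (h e h0), h'⟩

lemma IsEvenEdgeSet.even_card_cut {F : Finset ι} (hF : IsEvenEdgeSet s t F) (h : α → ZMod 2) :
    Even (F.filter fun e => h (s e) ≠ h (t e)).card := by
  have := hF h
  simp only [ZMod.two_add_eq_ite] at this
  rw [← ZMod.natCast_eq_zero_iff_even, Finset.card_filter, Nat.cast_sum, ← this]
  exact Finset.sum_congr rfl fun e _ => by split_ifs <;> simp_all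

/-- Even edge sets of the two contractions along a cut that agree on the cut glue together. -/
lemma IsEvenEdgeSet.glue [Fintype ι] {h : α → ZMod 2} {a b : α} (ha : h a = 0) (hb : h b ≠ 0)
    {F G : Finset ι}
    (hF : IsEvenEdgeSet ((fun v => if h v = 0 then a else v) ∘ s)
      ((fun v => if h v = 0 then a else v) ∘ t) F)
    (hG : IsEvenEdgeSet ((fun v => if h v = 0 then v else b) ∘ s)
      ((fun v => if h v = 0 then v else b) ∘ t) G)
    (hFG : ∀ e, h (s e) ≠ h (t e) → (e ∈ F ↔ e ∈ G)) :
    IsEvenEdgeSet s t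
      (Finset.univ.filter fun e => if h (s e) = 0 ∧ h (t e) = 0 then e ∈ G else e ∈ F) := by
  intro g
  have h1 := hF fun v => if h v = 0 then 0 else g v
  have h2 := hG fun v => if h v = 0 then g v else 0
  rw [sum_eq_sum_univ_ite] at h1 h2
  rw [Finset.sum_filter]
  refine Eq.trans ?_ ((congrArg₂ (· + ·) h1 h2).trans (add_zero 0))
  rw [← Finset.sum_add_distrib]
  refine Finset.sum_congr rfl fun e _ => ?_
  have := hFG e
  clear hFG hF hG h1 h2
  by_cases h3 : h (s e) = 0 <;> by_cases h4 : h (t e) = 0 <;> simp_all [Function.comp]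
  all_goals grind

/-- Charging `M` to every cut edge but `e₀`, which is refunded `M`, leaves only the even sets
with no cut edge or with two, one of them `e₀`, to be checked. -/
lemma isConservativeOn_add_cut_penalty [Fintype ι] {h : α → ZMod 2} {e₀ : ι} {b : ι → ℝ} {M : ℝ}
    (he₀ : h (s e₀) ≠ h (t e₀))
    (h0 : ∀ F, IsEvenEdgeSet s t F → (∀ e ∈ F, x e ≠ 0) → (∀ e ∈ F, h (s e) = h (t e)) →
      0 ≤ ∑ e ∈ F, b e)
    (h2 : ∀ F f, IsEvenEdgeSet s t F → (∀ e ∈ F, x e ≠ 0) → f ≠ e₀ →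
      (F.filter fun e => h (s e) ≠ h (t e)) = {e₀, f} → 0 ≤ ∑ e ∈ F, b e)
    (hM : ∑ e, |b e| ≤ M) :
    IsConservativeOn s t x fun e =>
      b e + M * if h (s e) = h (t e) then 0 else if e = e₀ then -1 else 1 := by
  intro F hF hx
  obtain ⟨k, hk⟩ := hF.even_card_cut h
  set C := F.filter fun e => h (s e) ≠ h (t e) with hC
  have hpen : (∑ e ∈ F, if h (s e) = h (t e) then (0 : ℝ) else if e = e₀ then -1 else 1) =
      C.card - 2 * if e₀ ∈ C then 1 else 0 := by
    have h3 : ∀ e, (if h (s e) = h (t e) then (0 : ℝ) else if e = e₀ then -1 else 1) =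
        if h (s e) ≠ h (t e) then (1 - 2 * if e = e₀ then 1 else 0) else 0 := by
      intro e; split_ifs <;> norm_num <;> simp_all
    simp only [h3]
    rw [← Finset.sum_filter, ← hC, Finset.sum_sub_distrib, ← Finset.mul_sum,
      Finset.sum_ite_eq']
    simp
  have hb : -M ≤ ∑ e ∈ F, b e := by
    have h3 := Finset.abs_sum_le_sum_abs b F
    have h4 := Finset.sum_le_sum_of_subset_of_nonneg (f := fun e => |b e|)
      (Finset.subset_univ F) fun _ _ _ => abs_nonneg _
    have := neg_abs_le (∑ e ∈ F, b e)
    linarith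
  have hM0 : 0 ≤ M := (Finset.sum_nonneg fun _ _ => abs_nonneg _).trans hM
  rw [Finset.sum_add_distrib, ← Finset.mul_sum, hpen]
  rcases Nat.eq_zero_or_pos k with rfl | hkpos
  · have hC0 : C = ∅ := by simpa using hk
    have := h0 F hF hx fun e he => by
      by_contra hne
      have : e ∈ C := Finset.mem_filter.2 ⟨he, hne⟩
      simp [hC0] at this
    simpa [hC0] using this
  · have hkr : (C.card : ℝ) = k + k := by rw [hk]; push_cast; rfl
    have hk1 : (1 : ℝ) ≤ k := by exact_mod_cast hkpos
    by_cases hm : e₀ ∈ C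
    · rw [if_pos hm, hkr]
      rcases Nat.eq_or_lt_of_le hkpos with h1 | h1
      · obtain ⟨f, hf⟩ := Finset.card_eq_one.1
          (show (C.erase e₀).card = 1 by rw [Finset.card_erase_of_mem hm]; omega)
        have hCf : C = {e₀, f} := by rw [← Finset.insert_erase hm, hf]
        have hfe : f ≠ e₀ := (Finset.mem_erase.1 (hf ▸ Finset.mem_singleton_self f)).1
        have := h2 F f hF hx hfe hCf
        rw [← h1]
        norm_num
        exact this
      · have : (2 : ℝ) ≤ k := by exact_mod_cast h1
        nlinarith
    · rw [if_neg hm, hkr]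
      nlinarith

lemma exists_min_or_eq {κ : Type*} [Fintype κ] (P : κ → Prop) (f : κ → ℝ) (K : ℝ) :
    ∃ m, (∀ i, P i → m ≤ f i) ∧ ((∃ i, P i ∧ f i = m) ∨ m = K) := by
  by_cases hP : ∃ i, P i
  · obtain ⟨i, hi⟩ := hP
    obtain ⟨j, hj, hmin⟩ := Finset.exists_min_image (Finset.univ.filter P) f ⟨i, by simpa using hi⟩
    simp only [Finset.mem_filter, Finset.mem_univ, true_and] at hj hmin
    exact ⟨f j, hmin, Or.inl ⟨j, hj, rfl⟩⟩
  · push Not at hP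
    exact ⟨K, fun i hi => absurd hi (hP i), Or.inr rfl⟩

/-- If the claim holds for all graphs with fewer vertices, it holds in the presence of a tight
cut with at least two vertices on either side. -/
lemma sum_mul_nonneg_of_tight_cut [Fintype α] [Fintype ι]
    (ih : ∀ (s' t' : ι → α) (c' : ι → ℝ),
      (supportVerts s' t' x).card < (supportVerts s t x).card →
      InCutCone s' t' x → IsConservativeOn s' t' x c' → 0 ≤ ∑ e, c' e * x e)
    (hx : InCutCone s t x) (hc : IsConservativeOn s t x c)
    {h : α → ZMod 2} {e₀ : ι} (he₀ : h (s e₀) ≠ h (t e₀)) (ht : cutSlack s t h e₀ x = 0)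
    {a a' b b' : α} (ha : a ∈ supportVerts s t x) (ha' : a' ∈ supportVerts s t x)
    (hb : b ∈ supportVerts s t x) (hb' : b' ∈ supportVerts s t x) (haa : a ≠ a') (hbb : b ≠ b')
    (ha0 : h a = 0) (ha0' : h a' = 0) (hb0 : h b ≠ 0) (hb0' : h b' ≠ 0) :
    0 ≤ ∑ e, c e * x e := by
  set r₁ : α → α := fun v => if h v = 0 then a else v with hr₁
  set r₂ : α → α := fun v => if h v = 0 then v else b with hr₂
  have hhr₁ : ∀ v, h (r₁ v) = h v := fun v => by
    by_cases hv : h v = 0 <;> simp [hr₁, hv, ha0]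
  have hz : ∀ z : ZMod 2, z ≠ 0 → z = 1 := by decide
  have hhr₂ : ∀ v, h (r₂ v) = h v := fun v => by
    by_cases hv : h v = 0
    · simp [hr₂, hv]
    · simp [hr₂, hz _ hb0, hz _ hv]
  set K := ∑ e, |c e| with hK
  have hsumK : ∀ (F : Finset ι) (d : ι → ℝ), (∀ e, |d e| ≤ |c e|) → -K ≤ ∑ e ∈ F, d e := by
    intro F d hd
    have h3 := Finset.abs_sum_le_sum_abs d F
    have h4 : ∑ e ∈ F, |d e| ≤ K :=
      (Finset.sum_le_sum fun e _ => hd e).trans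
        (Finset.sum_le_sum_of_subset_of_nonneg (Finset.subset_univ F) fun _ _ _ => abs_nonneg _)
    have := neg_abs_le (∑ e ∈ F, d e)
    linarith
  have hK0 : 0 ≤ K := Finset.sum_nonneg fun _ _ => abs_nonneg _
  -- the cost of the edges inside the first side, and of the others
  set cA : ι → ℝ := fun e => if h (s e) = 0 ∧ h (t e) = 0 then c e else 0 with hcA
  set cB : ι → ℝ := fun e => if h (s e) = 0 ∧ h (t e) = 0 then 0 else c e with hcB
  -- the least cost of joining `e₀` to `f` inside the first side
  choose m hm hm' using fun f : ι => exists_min_or_eq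
    (fun G : Finset ι => IsEvenEdgeSet (r₂ ∘ s) (r₂ ∘ t) G ∧ (∀ e ∈ G, x e ≠ 0) ∧
      (G.filter fun e => h (s e) ≠ h (t e)) = {e₀, f}) (fun G => ∑ e ∈ G, cA e) K
  set μ : ι → ℝ := fun e => if h (s e) = h (t e) ∨ e = e₀ then 0 else m e with hμ
  have hμsum : ∀ (F : Finset ι) (f : ι), f ≠ e₀ →
      (F.filter fun e => h (s e) ≠ h (t e)) = {e₀, f} → ∑ e ∈ F, μ e = m f := by
    intro F f hf hF
    have hfF : f ∈ F.filter fun e => h (s e) ≠ h (t e) := by simp [hF]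
    rw [Finset.mem_filter] at hfF
    rw [Finset.sum_eq_single f]
    · simp [hμ, hf, hfF.2]
    · intro e he hef
      by_contra hne
      simp only [hμ] at hne
      split_ifs at hne with h'
      · exact hne rfl
      · push Not at h'
        have : e ∈ F.filter fun e => h (s e) ≠ h (t e) := Finset.mem_filter.2 ⟨he, h'.1⟩
        rw [hF, Finset.mem_insert, Finset.mem_singleton] at this
        tauto
    · exact fun hn => absurd hfF.1 hn
  have hμ0 : ∀ F : Finset ι, (∀ e ∈ F, h (s e) = h (t e)) → ∑ e ∈ F, μ e = 0 :=
    fun F hF => Finset.sum_eq_zero fun e he => by simp [hμ, hF e he]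
  have hglue : ∀ F G : Finset ι, IsEvenEdgeSet (r₁ ∘ s) (r₁ ∘ t) F →
      IsEvenEdgeSet (r₂ ∘ s) (r₂ ∘ t) G → (∀ e ∈ F, x e ≠ 0) → (∀ e ∈ G, x e ≠ 0) →
      (∀ e, h (s e) ≠ h (t e) → (e ∈ F ↔ e ∈ G)) →
      0 ≤ ∑ e ∈ F, cB e + ∑ e ∈ G, cA e := by
    intro F G hF hG hFx hGx hFG
    have := hc _ (IsEvenEdgeSet.glue ha0 hb0 hF hG hFG) (by
      intro e he
      simp only [Finset.mem_filter, Finset.mem_univ, true_and] at he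
      split_ifs at he
      exacts [hGx e he, hFx e he])
    rw [Finset.sum_filter] at this
    rw [sum_eq_sum_univ_ite F, sum_eq_sum_univ_ite G, ← Finset.sum_add_distrib]
    refine this.trans_eq (Finset.sum_congr rfl fun e _ => ?_)
    simp only [hcA, hcB]
    split_ifs <;> simp
  have hfilt : ∀ {F G : Finset ι}, (F.filter fun e => h (s e) ≠ h (t e)) =
      (G.filter fun e => h (s e) ≠ h (t e)) → ∀ e, h (s e) ≠ h (t e) → (e ∈ F ↔ e ∈ G) := by
    intro F G hFG e he
    have := Finset.ext_iff.1 hFG e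
    simpa [he] using this
  set M := (∑ e, |cB e + μ e|) + ∑ e, |cA e - μ e| with hM
  have hMB : ∑ e, |cB e + μ e| ≤ M :=
    le_add_of_nonneg_right (Finset.sum_nonneg fun _ _ => abs_nonneg _)
  have hMA : ∑ e, |cA e - μ e| ≤ M :=
    le_add_of_nonneg_left (Finset.sum_nonneg fun _ _ => abs_nonneg _)
  have hempty : ∀ r : α → α, IsEvenEdgeSet (r ∘ s) (r ∘ t) (∅ : Finset ι) := fun r g => by simp
  have h₁ := ih (r₁ ∘ s) (r₁ ∘ t) _
    (card_supportVerts_comp_lt r₁ ha ha' haa (by simp [hr₁, ha0'])) (hx.comp r₁)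
    (isConservativeOn_add_cut_penalty (h := h) (e₀ := e₀) (b := fun e => cB e + μ e) (M := M)
      (by simpa [hhr₁] using he₀) (by
        intro F hF hFx hFc
        simp only [Function.comp, hhr₁] at hFc
        have := hglue F ∅ hF (hempty _) hFx (by simp) fun e he =>
          ⟨fun hm => absurd (hFc e hm) he, by simp⟩
        rw [Finset.sum_add_distrib, hμ0 F hFc]
        simpa using this) (by
        intro F f hF hFx hf hFc
        simp only [Function.comp, hhr₁] at hFc
        rw [Finset.sum_add_distrib, hμsum F f hf hFc]
        rcases hm' f with ⟨G, ⟨hG, hGx, hGc⟩, hGm⟩ | hmK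
        · rw [← hGm]
          exact hglue F G hF hG hFx hGx (hfilt (hFc.trans hGc.symm))
        · have := hsumK F cB fun e => by
            simp only [hcB]; split_ifs <;> simp
          linarith) hMB)
  have h₂ := ih (r₂ ∘ s) (r₂ ∘ t) _
    (card_supportVerts_comp_lt r₂ hb hb' hbb (by simp [hr₂, hb0'])) (hx.comp r₂)
    (isConservativeOn_add_cut_penalty (h := h) (e₀ := e₀) (b := fun e => cA e - μ e) (M := M)
      (by simpa [hhr₂] using he₀) (by
        intro G hG hGx hGc
        simp only [Function.comp, hhr₂] at hGc
        have := hglue ∅ G (hempty _) hG (by simp) hGx fun e he =>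
          ⟨by simp, fun hm => absurd (hGc e hm) he⟩
        rw [Finset.sum_sub_distrib, hμ0 G hGc]
        simpa using this) (by
        intro G f hG hGx hf hGc
        simp only [Function.comp, hhr₂] at hGc
        rw [Finset.sum_sub_distrib, hμsum G f hf hGc]
        exact sub_nonneg.2 (hm f G ⟨hG, hGx, hGc⟩)) hMA)
  simp only [Function.comp, hhr₁] at h₁
  simp only [Function.comp, hhr₂] at h₂
  have hpen : (∑ e, (if h (s e) = h (t e) then (0 : ℝ) else if e = e₀ then -1 else 1) * x e) =
      0 := by
    rw [cutSlack_of_ne he₀] at ht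
    refine Eq.trans ?_ ht
    rw [show 2 * x e₀ = ∑ e, if e = e₀ then 2 * x e else 0 by simp, ← Finset.sum_sub_distrib]
    refine Finset.sum_congr rfl fun e _ => ?_
    by_cases hee : e = e₀
    · subst hee; simp [he₀]; ring
    · simp [hee]
  have hsum : ∀ d : ι → ℝ, ∑ e, (d e + M * if h (s e) = h (t e) then (0 : ℝ) else
      if e = e₀ then -1 else 1) * x e = ∑ e, d e * x e := by
    intro d
    simp only [add_mul, mul_assoc]
    rw [Finset.sum_add_distrib, ← Finset.mul_sum, hpen]
    simp
  rw [hsum] at h₁ h₂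
  refine (add_nonneg h₁ h₂).trans_eq ?_
  rw [← Finset.sum_add_distrib]
  refine Finset.sum_congr rfl fun e _ => ?_
  rw [← add_mul]
  congr 1
  simp only [hcA, hcB]
  split_ifs <;> ring

lemma starCut_ne_iff {v a b : α} :
    ((if a = v then (1 : ZMod 2) else 0) ≠ if b = v then 1 else 0) ↔
      a ≠ b ∧ (a = v ∨ b = v) := by
  split_ifs <;> simp_all
  exact fun h => ‹¬b = v› h.symm

lemma mem_supportVerts_left [Fintype α] {e : ι} (he : x e ≠ 0) (hne : s e ≠ t e) :
    s e ∈ supportVerts s t x := by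
  simpa [supportVerts] using ⟨e, he, hne, Or.inl rfl⟩

lemma mem_supportVerts_right [Fintype α] {e : ι} (he : x e ≠ 0) (hne : s e ≠ t e) :
    t e ∈ supportVerts s t x := by
  simpa [supportVerts] using ⟨e, he, hne, Or.inr rfl⟩

/-- If the claim holds for all graphs with fewer vertices, it holds if some vertex `v` has degree
two in the support. -/
lemma sum_mul_nonneg_of_degree_two [Fintype α] [Fintype ι]
    (ih : ∀ (s' t' : ι → α) (c' : ι → ℝ),
      (supportVerts s' t' x).card < (supportVerts s t x).card →
      InCutCone s' t' x → IsConservativeOn s' t' x c' → 0 ≤ ∑ e, c' e * x e)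
    (hx : InCutCone s t x) (hc : IsConservativeOn s t x c) {v : α} {e f : ι} (hef : e ≠ f)
    (hstar : ∀ g, (x g ≠ 0 ∧ s g ≠ t g ∧ (s g = v ∨ t g = v)) ↔ g = e ∨ g = f) :
    0 ≤ ∑ e, c e * x e := by
  obtain ⟨hxe, hne, hve⟩ := (hstar e).2 (Or.inl rfl)
  obtain ⟨hxf, hnf, hvf⟩ := (hstar f).2 (Or.inr rfl)
  set h : α → ZMod 2 := fun w => if w = v then 1 else 0 with hh
  have hcut : ∀ g, x g ≠ 0 → (h (s g) ≠ h (t g) ↔ g = e ∨ g = f) := fun g hg => by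
    rw [← hstar g]; simp only [hh, starCut_ne_iff]; tauto
  have hsum : (∑ g, if h (s g) = h (t g) then 0 else x g) = x e + x f := by
    rw [← Finset.sum_pair hef, sum_eq_sum_univ_ite {e, f}]
    refine Finset.sum_congr rfl fun g _ => ?_
    by_cases hg : x g = 0
    · simp [hg]
    · have := hcut g hg
      simp only [Finset.mem_insert, Finset.mem_singleton, ← this]
      by_cases h' : h (s g) = h (t g) <;> simp [h']
  have hxef : x e = x f := by
    have h1 := hx.2 h e
    have h2 := hx.2 h f
    rw [cutSlack_of_ne ((hcut e hxe).2 (Or.inl rfl)), hsum] at h1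
    rw [cutSlack_of_ne ((hcut f hxf).2 (Or.inr rfl)), hsum] at h2
    linarith
  obtain ⟨u, huv, hu, hue⟩ : ∃ u, u ≠ v ∧ u ∈ supportVerts s t x ∧
      ((s e = v ∧ t e = u) ∨ (s e = u ∧ t e = v)) := by
    rcases hve with h1 | h1
    · exact ⟨t e, fun h2 => hne (h1.trans h2.symm), mem_supportVerts_right hxe hne,
        Or.inl ⟨h1, rfl⟩⟩
    · exact ⟨s e, fun h2 => hne (h2.trans h1.symm), mem_supportVerts_left hxe hne,
        Or.inr ⟨rfl, h1⟩⟩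
  have hv : v ∈ supportVerts s t x := by
    simpa [supportVerts] using ⟨e, hxe, hne, hve⟩
  set r : α → α := fun w => if w = v then u else w with hr
  have hre : r (s e) = r (t e) := by
    rcases hue with ⟨h1, h2⟩ | ⟨h1, h2⟩ <;> simp [hr, h1, h2]
  have key := ih (r ∘ s) (r ∘ t)
    (fun g => (c g - if g = e then c e else 0) + if g = f then c e else 0)
    (card_supportVerts_comp_lt r hu hv huv (by simp [hr])) (hx.comp r) (by
      intro F hF hFx
      have hcF := hc (Finset.univ.filter fun g => if g = e then f ∈ F else g ∈ F) (by
        intro k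
        have h1 := hF k
        rw [sum_eq_sum_univ_ite] at h1
        have hk : ∀ w, k w = k (r w) + (k v - k u) * h w := fun w => by
          by_cases hw : w = v <;> simp [hr, hh, hw]
        have h2 : (∑ g, if g = e ∨ g = f then (if f ∈ F then (1 : ZMod 2) else 0) else 0) = 0 := by
          rw [show (∑ g, if g = e ∨ g = f then (if f ∈ F then (1 : ZMod 2) else 0) else 0) =
            ∑ g ∈ {e, f}, (if f ∈ F then (1 : ZMod 2) else 0) by
              rw [sum_eq_sum_univ_ite {e, f}]; simp only [Finset.mem_insert, Finset.mem_singleton],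
            Finset.sum_pair hef]
          exact CharTwo.add_self_eq_zero _
        rw [Finset.sum_filter]
        refine Eq.trans ?_ ((congrArg₂ (fun p q => p + (k v - k u) * q) h1 h2).trans (by simp))
        rw [Finset.mul_sum, ← Finset.sum_add_distrib]
        refine Finset.sum_congr rfl fun g _ => ?_
        have hadd : k (s g) + k (t g) =
            (k (r (s g)) + k (r (t g))) + (k v - k u) * (h (s g) + h (t g)) := by
          rw [hk (s g), hk (t g)]; ring
        rw [hadd, ZMod.two_add_eq_ite (h (s g))]
        simp only [Function.comp]
        by_cases hge : g = e
        · subst hge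
          have h3 := (hcut g hxe).2 (Or.inl rfl)
          rw [hre, CharTwo.add_self_eq_zero]
          by_cases hfF : f ∈ F <;> simp [h3, hfF]
        · by_cases hgf : g = f
          · subst hgf
            have h3 := (hcut g hxf).2 (Or.inr rfl)
            by_cases hfF : g ∈ F <;> simp [h3, hfF, hge]
          · by_cases hgF : g ∈ F
            · have h3 : h (s g) = h (t g) := by
                by_contra h4
                exact ((hcut g (hFx g hgF)).1 h4).elim hge hgf
              simp [h3, hgF, hge, hgf]
            · simp [hgF, hge, hgf]) (by
        intro g hg
        simp only [Finset.mem_filter, Finset.mem_univ, true_and] at hg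
        split_ifs at hg with h1
        exacts [h1 ▸ hxe, hFx g hg])
      refine hcF.trans_eq ?_
      rw [Finset.sum_filter, Finset.sum_add_distrib, Finset.sum_ite_eq', sum_eq_sum_univ_ite F]
      rw [show (if f ∈ F then c e else 0) = ∑ g, if g = e then (if f ∈ F then c e else 0) else 0 by
        simp, ← Finset.sum_add_distrib]
      refine Finset.sum_congr rfl fun g _ => ?_
      by_cases hge : g = e
      · subst hge; simp
      · simp [hge])
  refine key.trans_eq ?_
  simp only [add_mul, sub_mul, ite_mul, zero_mul]
  rw [Finset.sum_add_distrib, Finset.sum_sub_distrib, Finset.sum_ite_eq', Finset.sum_ite_eq']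
  simp [hxef]

lemma cutSlack_pos [Fintype ι] (hx : ∀ e, 0 ≤ x e) {h : α → ZMod 2} {g a b : ι}
    (hg : h (s g) ≠ h (t g)) (ha : h (s a) ≠ h (t a)) (hb : h (s b) ≠ h (t b))
    (hga : g ≠ a) (hgb : g ≠ b) (hab : a ≠ b) (hle : x g ≤ x a) (hpos : x b ≠ 0) :
    0 < cutSlack s t h g x := by
  have h1 : ∑ e ∈ {g, a, b}, (if h (s e) = h (t e) then 0 else x e) ≤
      ∑ e, if h (s e) = h (t e) then 0 else x e :=
    Finset.sum_le_sum_of_subset_of_nonneg (Finset.subset_univ _)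
      fun e _ _ => by split_ifs; exacts [le_rfl, hx e]
  rw [Finset.sum_insert (by simp [hga, hgb]), Finset.sum_pair hab, if_neg hg, if_neg ha,
    if_neg hb] at h1
  rw [cutSlack_of_ne hg]
  have := (hx b).lt_of_ne' hpos
  linarith

/-- If every vertex of the support has degree at least three and every tight cut is a star, then
`x` can be moved without increasing the cost or losing a tight inequality. -/
lemma exists_descent_direction [Fintype α] [Fintype ι] (hx : InCutCone s t x)
    (hc : IsConservativeOn s t x c) (hne : ∀ e, x e ≠ 0 → s e ≠ t e) (hx0 : ∃ e, x e ≠ 0)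
    (hdeg : ∀ v ∈ supportVerts s t x,
      3 ≤ (Finset.univ.filter fun g => x g ≠ 0 ∧ (s g = v ∨ t g = v)).card)
    (htight : ∀ h e, x e ≠ 0 → h (s e) ≠ h (t e) → cutSlack s t h e x = 0 →
      ∃ v ∈ supportVerts s t x, ∀ g, x g ≠ 0 → (h (s g) ≠ h (t g) ↔ (s g = v ∨ t g = v))) :
    ∃ z : ι → ℝ, (∀ e, x e = 0 → z e = 0) ∧
      (∀ h e, x e ≠ 0 → cutSlack s t h e x = 0 → cutSlack s t h e z = 0) ∧
      ∑ e, c e * z e ≤ 0 ∧ ∃ e, z e < 0 := by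
  set S := Finset.univ.filter fun e => x e ≠ 0 with hS
  set V := supportVerts s t x with hV
  have hthird : ∀ v ∈ V, ∀ e e', ∃ b, x b ≠ 0 ∧ (s b = v ∨ t b = v) ∧ b ≠ e ∧ b ≠ e' := by
    intro v hv e e'
    have h1 : ({e, e'} : Finset ι).card <
        (Finset.univ.filter fun g => x g ≠ 0 ∧ (s g = v ∨ t g = v)).card :=
      (Finset.card_le_two).trans_lt (hdeg v hv)
    obtain ⟨b, hb, hb'⟩ := Finset.exists_mem_notMem_of_card_lt_card h1
    simp only [Finset.mem_filter, Finset.mem_univ, true_and, Finset.mem_insert,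
      Finset.mem_singleton, not_or] at hb hb'
    exact ⟨b, hb.1, hb.2, hb'.1, hb'.2⟩
  by_cases hcard : V.card + 1 < S.card
  · let star (v : α) (z : ι → ℝ) : ℝ := ∑ g, if s g = v ∨ t g = v then z g else 0
    have hslack : ∀ h e v, (∀ g, x g ≠ 0 → (h (s g) ≠ h (t g) ↔ (s g = v ∨ t g = v))) →
        x e ≠ 0 → h (s e) ≠ h (t e) → ∀ z : ι → ℝ, (∀ e, x e = 0 → z e = 0) →
        cutSlack s t h e z = star v z - 2 * z e := by
      intro h e v hv hxe he z hz
      rw [cutSlack_of_ne he]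
      congr 1
      refine Finset.sum_congr rfl fun g _ => ?_
      by_cases hg : x g = 0
      · simp [hz g hg]
      · have := hv g hg
        by_cases h' : h (s g) = h (t g) <;> simp_all
    obtain ⟨e₁, -⟩ := hx0
    have hex : ∀ v : α, ∃ o : ι, v ∈ V → ∀ e, x e ≠ 0 → (s e = v ∨ t e = v) →
        star v x - 2 * x e = 0 → e = o := by
      intro v
      by_cases hv : v ∈ V ∧ ∃ o, x o ≠ 0 ∧ (s o = v ∨ t o = v) ∧ star v x - 2 * x o = 0
      · obtain ⟨hv, o, hxo, hvo, ho⟩ := hv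
        refine ⟨o, fun _ e hxe hve he => ?_⟩
        by_contra heo
        obtain ⟨b, hxb, hvb, hbe, hbo⟩ := hthird v hv e o
        set h : α → ZMod 2 := fun w => if w = v then 1 else 0 with hh
        have hcut : ∀ g, x g ≠ 0 → (h (s g) ≠ h (t g) ↔ (s g = v ∨ t g = v)) := fun g hg => by
          simp [hh, starCut_ne_iff, hne g hg]
        have := cutSlack_pos hx.1 ((hcut e hxe).2 hve) ((hcut o hxo).2 hvo) ((hcut b hxb).2 hvb)
          heo hbe.symm hbo.symm (by linarith) hxb
        rw [hslack h e v hcut hxe ((hcut e hxe).2 hve) x fun _ => id] at this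
        linarith
      · exact ⟨e₁, fun hvV e hxe hve he => absurd ⟨hvV, e, hxe, hve, he⟩ hv⟩
    choose o ho using hex
    let Φ : (ι → ℝ) →ₗ[ℝ] ({e // x e = 0} → ℝ) × (V → ℝ) × ℝ :=
      (LinearMap.pi fun e => LinearMap.proj e.1).prod
        ((LinearMap.pi fun v => ∑ g, (if s g = v.1 ∨ t g = v.1 then (1 : ℝ) else 0) •
          LinearMap.proj g - (2 : ℝ) • LinearMap.proj (o v.1)).prod
        (∑ g, c g • LinearMap.proj g))
    have hrank : Module.finrank ℝ (({e // x e = 0} → ℝ) × (V → ℝ) × ℝ) <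
        Module.finrank ℝ (ι → ℝ) := by
      rw [Module.finrank_prod, Module.finrank_prod, Module.finrank_fintype_fun_eq_card,
        Module.finrank_fintype_fun_eq_card, Module.finrank_fintype_fun_eq_card,
        Module.finrank_self, Fintype.card_coe, Fintype.card_subtype]
      have := Finset.card_filter_add_card_filter_not (s := Finset.univ) (fun e : ι => x e = 0)
      rw [Finset.card_univ] at this
      change _ + S.card = _ at this
      omega
    obtain ⟨z, hz, hz0⟩ :=
      (Submodule.ne_bot_iff _).1 (LinearMap.ker_ne_bot_of_finrank_lt (f := Φ) hrank)
    have hz' : (∀ e, x e = 0 → z e = 0) ∧ (∀ v ∈ V, star v z - 2 * z (o v) = 0) ∧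
        ∑ e, c e * z e = 0 := by
      have h1 : Φ z = 0 := hz
      refine ⟨fun e he => ?_, fun v hv => ?_, ?_⟩
      · exact congrFun (congrArg Prod.fst h1) ⟨e, he⟩
      · have := congrFun (congrArg (fun p => p.2.1) h1) ⟨v, hv⟩
        simpa [Φ, star, LinearMap.sum_apply, -ite_smul] using this
      · have := congrArg (fun p => p.2.2) h1
        simpa [Φ, LinearMap.sum_apply] using this
    obtain ⟨hzx, hzV, hzc⟩ := hz'
    have hzs : ∀ h e, x e ≠ 0 → cutSlack s t h e x = 0 → cutSlack s t h e z = 0 := by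
      intro h e hxe he
      by_cases hh : h (s e) = h (t e)
      · exact cutSlack_of_eq hh z
      · obtain ⟨v, hv, hcut⟩ := htight h e hxe hh he
        rw [hslack h e v hcut hxe hh x fun _ => id] at he
        rw [hslack h e v hcut hxe hh z hzx, ho v hv e hxe ((hcut e hxe).1 hh) he]
        exact hzV v hv
    obtain ⟨e, he⟩ := Function.ne_iff.1 hz0
    rcases lt_or_gt_of_ne he with he | he
    · exact ⟨z, hzx, hzs, hzc.le, e, he⟩
    · have hneg : ∀ h e, cutSlack s t h e (fun e => -z e) = - cutSlack s t h e z := by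
        intro h e
        have := cutSlack_add_smul s t h e (fun _ => 0) z (-1)
        simp only [zero_add, neg_one_mul] at this
        rw [this]; simp [cutSlack]
      refine ⟨fun e => -z e, fun e h => by simp [hzx e h], fun h e h1 h2 => ?_, ?_, e, ?_⟩
      · rw [hneg, hzs h e h1 h2, neg_zero]
      · simp [hzc]
      · simpa using he
  · have hcount : 3 * V.card ≤ 2 * S.card := by
      calc 3 * V.card = ∑ v ∈ V, 3 := by simp [mul_comm]
        _ ≤ ∑ v ∈ V, ∑ g ∈ S, if s g = v ∨ t g = v then 1 else 0 := by
          refine Finset.sum_le_sum fun v hv => (hdeg v hv).trans_eq ?_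
          rw [← Finset.card_filter, hS, Finset.filter_filter]
        _ = ∑ g ∈ S, ∑ v ∈ V, if s g = v ∨ t g = v then 1 else 0 := Finset.sum_comm
        _ ≤ ∑ g ∈ S, 2 := by
          refine Finset.sum_le_sum fun g _ => ?_
          rw [← Finset.card_filter]
          refine (Finset.card_le_card (t := {s g, t g}) fun v hv => ?_).trans Finset.card_le_two
          simp only [Finset.mem_filter, Finset.mem_insert, Finset.mem_singleton] at hv ⊢
          exact hv.2.imp Eq.symm Eq.symm
        _ = 2 * S.card := by simp [mul_comm]
    obtain ⟨e, he, hmax⟩ := Finset.exists_max_image S x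
      (by obtain ⟨e, he⟩ := hx0; exact ⟨e, by simpa [hS] using he⟩)
    simp only [hS, Finset.mem_filter, Finset.mem_univ, true_and] at he hmax
    have hVe : V = {s e, t e} := by
      refine (Finset.eq_of_subset_of_card_le ?_ ?_).symm
      · intro v hv
        simp only [Finset.mem_insert, Finset.mem_singleton] at hv
        rcases hv with rfl | rfl
        exacts [mem_supportVerts_left he (hne e he), mem_supportVerts_right he (hne e he)]
      · rw [Finset.card_pair (hne e he)]; omega
    have hends : ∀ g, x g ≠ 0 → ∀ k : α → ZMod 2, k (s g) + k (t g) = k (s e) + k (t e) := by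
      intro g hg k
      have h1 : s g ∈ V := mem_supportVerts_left hg (hne g hg)
      have h2 : t g ∈ V := mem_supportVerts_right hg (hne g hg)
      have h3 := hne g hg
      rw [hVe, Finset.mem_insert, Finset.mem_singleton] at h1 h2
      rcases h1 with h1 | h1 <;> rcases h2 with h2 | h2
      · exact absurd (h1.trans h2.symm) h3
      · rw [h1, h2]
      · rw [h1, h2, add_comm]
      · exact absurd (h1.trans h2.symm) h3
    have hcut : ∀ g, x g ≠ 0 → ∀ k : α → ZMod 2, (k (s g) ≠ k (t g) ↔ k (s e) ≠ k (t e)) := by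
      intro g hg k
      have := hends g hg k
      rw [ZMod.two_add_eq_ite, ZMod.two_add_eq_ite] at this
      split_ifs at this <;> simp_all
    have hse : s e ∈ V := mem_supportVerts_left he (hne e he)
    obtain ⟨f, hxf, -, hfe, -⟩ := hthird (s e) hse e e
    refine ⟨fun g => if g = e ∨ g = f then -1 else 0, fun g hg => ?_, fun h g hxg hg => ?_, ?_,
      e, by simp⟩
    · refine if_neg ?_
      rintro (rfl | rfl)
      exacts [he hg, hxf hg]
    · by_cases hh : h (s g) = h (t g)
      · exact cutSlack_of_eq hh _
      · have hhe := (hcut g hxg h).1 hh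
        have hge : g = e := by
          by_contra hge
          obtain ⟨b, hxb, -, hbe, hbg⟩ := hthird (s e) hse e g
          exact (cutSlack_pos hx.1 hh hhe ((hcut b hxb h).2 hhe) hge hbg.symm hbe.symm
            (hmax g hxg) hxb).ne' hg
        subst hge
        rw [cutSlack_of_ne hh]
        have : (∑ k, if h (s k) = h (t k) then (0 : ℝ) else if k = g ∨ k = f then -1 else 0) =
            ∑ k ∈ {g, f}, (-1 : ℝ) := by
          rw [sum_eq_sum_univ_ite {g, f}]
          refine Finset.sum_congr rfl fun k _ => ?_
          by_cases hk : k = g ∨ k = f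
          · have : h (s k) ≠ h (t k) := by
              rcases hk with rfl | rfl
              exacts [hh, (hcut k hxf h).2 hhe]
            simp [this, hk]
          · simp [hk]
        rw [this, Finset.sum_pair hfe.symm]
        norm_num
    · have := hc {e, f} (fun k => by
        rw [Finset.sum_pair hfe.symm, hends f hxf k]
        exact CharTwo.add_self_eq_zero _) (by simp [he, hxf])
      rw [sum_eq_sum_univ_ite] at this
      have h1 : ∑ g, c g * (if g = e ∨ g = f then (-1 : ℝ) else 0) =
          -∑ g, if g ∈ ({e, f} : Finset ι) then c g else 0 := by
        rw [← Finset.sum_neg_distrib]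
        exact Finset.sum_congr rfl fun g _ => by
          by_cases hg : g = e ∨ g = f <;> simp [hg]
      rw [h1]; linarith

/-- A cost vector that is nonnegative on even edge sets is nonnegative on the cut cone. -/
theorem InCutCone.sum_mul_nonneg [Fintype α] [Fintype ι] (hx : InCutCone s t x)
    (hc : IsConservativeOn s t x c) : 0 ≤ ∑ e, c e * x e := by
  induction hn : (supportVerts s t x).card using Nat.strong_induction_on
    generalizing s t c x with
  | _ n ihn =>
  induction hk : strictCount s t x using Nat.strong_induction_on generalizing s t c x with
  | _ k ihk =>
  subst hn hk
  have hdescend : ∀ z : ι → ℝ, (∀ e, x e = 0 → z e = 0) →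
      (∀ h e, x e ≠ 0 → cutSlack s t h e x = 0 → cutSlack s t h e z = 0) →
      ∑ e, c e * z e ≤ 0 → (∃ e, z e < 0) → 0 ≤ ∑ e, c e * x e := by
    intro z hz hs hcz hneg
    obtain ⟨x', hx', hsupp, hcx, hlt⟩ := hx.exists_strictCount_lt hz hs hcz hneg
    have hc' : IsConservativeOn s t x' c := fun F hF hFx =>
      hc F hF fun e he h0 => hFx e he (hsupp e h0)
    refine le_trans ?_ hcx
    rcases (Finset.card_le_card (supportVerts_subset (s := s) (t := t) hsupp)).lt_or_eq with h | h
    · exact ihn _ h hx' hc' rfl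
    · exact ihk _ hlt hx' hc' h rfl
  have ih : ∀ (s' t' : ι → α) (c' : ι → ℝ),
      (supportVerts s' t' x).card < (supportVerts s t x).card →
      InCutCone s' t' x → IsConservativeOn s' t' x c' → 0 ≤ ∑ e, c' e * x e :=
    fun s' t' c' hlt hx' hc' => ihn _ hlt hx' hc' rfl
  by_cases hloop : ∃ e, x e ≠ 0 ∧ s e = t e
  · obtain ⟨e, hxe, he⟩ := hloop
    refine hdescend (fun g => if g = e then -1 else 0) (fun g hg => ?_) (fun h g hxg _ => ?_) ?_
      ⟨e, by simp⟩
    · rw [if_neg]; rintro rfl; exact hxe hg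
    · by_cases hh : h (s g) = h (t g)
      · exact cutSlack_of_eq hh _
      · have hge : g ≠ e := by rintro rfl; exact hh (by rw [he])
        rw [cutSlack_of_ne hh, if_neg hge, mul_zero, sub_zero]
        refine Finset.sum_eq_zero fun f _ => ?_
        by_cases hfe : f = e
        · subst hfe; simp [he]
        · simp [hfe]
    · have := hc {e} (fun k => by simp [he, CharTwo.add_self_eq_zero]) (by simpa using hxe)
      simpa using this
  push Not at hloop
  by_cases hx0 : ∃ e, x e ≠ 0
  swap
  · push Not at hx0
    simp [hx0]
  by_cases hbig : ∃ h e, x e ≠ 0 ∧ h (s e) ≠ h (t e) ∧ cutSlack s t h e x = 0 ∧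
      ∀ v, (v = s e ∨ v = t e) → ∃ w ∈ supportVerts s t x, h w = h v ∧ w ≠ v
  · obtain ⟨h, e, hxe, he, ht, hw⟩ := hbig
    obtain ⟨p, hp, hps, hpne⟩ := hw (s e) (Or.inl rfl)
    obtain ⟨q, hq, hqs, hqne⟩ := hw (t e) (Or.inr rfl)
    have hsV := mem_supportVerts_left hxe (hloop e hxe)
    have htV := mem_supportVerts_right hxe (hloop e hxe)
    by_cases h0 : h (s e) = 0
    · have h1 : h (t e) ≠ 0 := fun h1 => he (h0.trans h1.symm)
      exact sum_mul_nonneg_of_tight_cut ih hx hc he ht hsV hp htV hq hpne.symm hqne.symm h0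
        (hps.trans h0) h1 (hqs ▸ h1)
    · have h1 : h (t e) = 0 := by
        revert he h0
        generalize h (s e) = i
        generalize h (t e) = j
        revert i j; decide
      exact sum_mul_nonneg_of_tight_cut ih hx hc he ht htV hq hsV hp hqne.symm hpne.symm h1
        (hqs.trans h1) h0 (hps ▸ h0)
  push Not at hbig
  have hdeg2 : ∀ v ∈ supportVerts s t x,
      2 ≤ (Finset.univ.filter fun g => x g ≠ 0 ∧ (s g = v ∨ t g = v)).card := by
    intro v hv
    by_contra hlt
    obtain ⟨e, hxe, hne, hve⟩ : ∃ e, x e ≠ 0 ∧ s e ≠ t e ∧ (s e = v ∨ t e = v) := by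
      simpa [supportVerts] using hv
    have honly : ∀ g, x g ≠ 0 → (s g = v ∨ t g = v) → g = e := fun g hg hvg =>
      Finset.card_le_one.1 (Nat.lt_succ_iff.1 (not_le.1 hlt)) g (by simp [hg, hvg]) e
        (by simp [hxe, hve])
    have h1 := hx.2 (fun w => if w = v then 1 else 0) e
    rw [cutSlack_of_ne (by rw [starCut_ne_iff]; exact ⟨hne, hve⟩),
      Finset.sum_eq_single e] at h1
    · have : (if (if s e = v then (1 : ZMod 2) else 0) = if t e = v then 1 else 0 then 0
        else x e) ≤ x e := by split_ifs <;> simp [hx.1 e]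
      have := (hx.1 e).lt_of_ne' hxe
      linarith
    · intro g _ hge
      by_contra h2
      rw [ite_eq_left_iff, Classical.not_imp] at h2
      exact hge (honly g h2.2 (starCut_ne_iff.1 h2.1).2)
    · simp
  by_cases htwo : ∃ v, (Finset.univ.filter fun g => x g ≠ 0 ∧ (s g = v ∨ t g = v)).card = 2
  · obtain ⟨v, hv⟩ := htwo
    obtain ⟨e, f, hef, hD⟩ := Finset.card_eq_two.1 hv
    refine sum_mul_nonneg_of_degree_two (v := v) ih hx hc hef fun g => ?_
    have := Finset.ext_iff.1 hD g
    simp only [Finset.mem_filter, Finset.mem_univ, true_and, Finset.mem_insert,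
      Finset.mem_singleton] at this
    rw [← this]
    exact ⟨fun h => ⟨h.1, h.2.2⟩, fun h => ⟨h.1, hloop g h.1, h.2⟩⟩
  push Not at htwo
  obtain ⟨z, hz, hs, hcz, hneg⟩ := exists_descent_direction hx hc hloop hx0
    (fun v hv => lt_of_le_of_ne (hdeg2 v hv) (htwo v).symm) (by
      intro h e hxe he ht
      obtain ⟨v, hv, hw⟩ := hbig h e hxe he ht
      refine ⟨v, ?_, fun g hg => ?_⟩
      · rcases hv with rfl | rfl
        exacts [mem_supportVerts_left hxe (hloop e hxe), mem_supportVerts_right hxe (hloop e hxe)]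
      · have h1 := hw _ (mem_supportVerts_left hg (hloop g hg))
        have h2 := hw _ (mem_supportVerts_right hg (hloop g hg))
        have h3 := hloop g hg
        constructor
        · intro h4
          have : h (s g) = h v ∨ h (t g) = h v := by
            revert h4
            generalize h (s g) = i
            generalize h (t g) = j
            generalize h v = k
            revert i j k; decide
          exact this.imp h1 h2
        · rintro (h4 | h4) h5
          · exact h3 (h4.trans (h2 (by rw [← h5, h4])).symm)
          · exact h3 ((h1 (by rw [h5, h4])).trans h4.symm))
  exact hdescend z hz hs hcz hneg

end Cone

section SimpleGraph

variable {V : Type*} {s t : Sym2 V → V}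

lemma ends_add_ends (hst : ∀ e, s(s e, t e) = e) (k : V → ZMod 2) (a b : V) :
    k (s s(a, b)) + k (t s(a, b)) = k a + k b := by
  rcases Sym2.eq_iff.1 (hst s(a, b)) with ⟨h1, h2⟩ | ⟨h1, h2⟩
  · rw [h1, h2]
  · rw [h1, h2, add_comm]

lemma SimpleGraph.Walk.sum_map_edges_ends {G : SimpleGraph V} (hst : ∀ e, s(s e, t e) = e)
    (k : V → ZMod 2) {a b : V} (W : G.Walk a b) :
    (W.edges.map fun e => k (s e) + k (t e)).sum = k a + k b := by
  induction W with
  | nil => simp [CharTwo.add_self_eq_zero]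
  | @cons u v w _ p ih =>
    rw [SimpleGraph.Walk.edges_cons, List.map_cons, List.sum_cons, ih, ends_add_ends hst,
      add_assoc, ← add_assoc (k v), CharTwo.add_self_eq_zero, zero_add]

lemma SimpleGraph.Walk.IsCycle.isEvenEdgeSet [DecidableEq V] {G : SimpleGraph V}
    (hst : ∀ e, s(s e, t e) = e) {a : V} {C : G.Walk a a} (hC : C.IsCycle) :
    IsEvenEdgeSet s t C.edges.toFinset := fun k => by
  rw [List.sum_toFinset _ hC.edges_nodup, C.sum_map_edges_ends hst, CharTwo.add_self_eq_zero]

/-- A nonempty even set of edges contains a cycle. -/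
lemma IsEvenEdgeSet.exists_isCycle [DecidableEq V] {G : SimpleGraph V}
    (hst : ∀ e, s(s e, t e) = e) {F : Finset (Sym2 V)} (hF : IsEvenEdgeSet s t F)
    (hFG : ∀ e ∈ F, e ∈ G.edgeSet) (hne : F.Nonempty) :
    ∃ (a : V) (C : G.Walk a a), C.IsCycle ∧ C.edges.toFinset ⊆ F := by
  set H := SimpleGraph.fromEdgeSet (F : Set (Sym2 V)) with hH
  have hHF : ∀ e ∈ H.edgeSet, e ∈ F := fun e he => by
    rw [hH, SimpleGraph.edgeSet_fromEdgeSet] at he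
    exact he.1
  have hHG : H ≤ G := SimpleGraph.edgeSet_subset_edgeSet.1 fun e he => hFG e (hHF e he)
  have hFH : ∀ e ∈ F, e ∈ H.edgeSet := fun e he => by
    rw [hH, SimpleGraph.edgeSet_fromEdgeSet]
    exact ⟨he, G.not_isDiag_of_mem_edgeSet (hFG e he)⟩
  obtain ⟨e, he⟩ := hne
  have hnb : ¬ H.IsBridge e := by
    induction e using Sym2.ind with
    | _ a b =>
    intro hb
    rw [SimpleGraph.isBridge_iff] at hb
    set k : V → ZMod 2 := fun v => if (H.deleteEdges {s(a, b)}).Reachable a v then 1 else 0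
      with hk
    have h1 := hF k
    rw [Finset.sum_eq_single_of_mem _ he, ends_add_ends hst] at h1
    · simp [hk, hb] at h1
    · intro f hf hfe
      induction f using Sym2.ind with
      | _ p q =>
      have hadj : (H.deleteEdges {s(a, b)}).Adj p q := by
        rw [SimpleGraph.deleteEdges_adj]
        exact ⟨hFH _ hf, hfe⟩
      have : (H.deleteEdges {s(a, b)}).Reachable a p ↔ (H.deleteEdges {s(a, b)}).Reachable a q :=
        ⟨fun h => h.trans hadj.reachable, fun h => h.trans hadj.symm.reachable⟩
      rw [ends_add_ends hst]
      simp only [hk, this]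
      exact CharTwo.add_self_eq_zero _
  rw [SimpleGraph.isBridge_iff_forall_cycle_notMem (hFH e he)] at hnb
  push Not at hnb
  obtain ⟨u, C, hC, -⟩ := hnb
  refine ⟨u, C.mapLe hHG, hC.mapLe hHG, fun f hf => ?_⟩
  rw [List.mem_toFinset, SimpleGraph.Walk.edges_mapLe_eq_edges] at hf
  exact hHF f (C.edges_subset_edgeSet hf)

lemma IsEvenEdgeSet.sum_nonneg [DecidableEq V] {G : SimpleGraph V}
    (hst : ∀ e, s(s e, t e) = e) {c : Sym2 V → ℝ}
    (hc : ∀ (a : V) (C : G.Walk a a), C.IsCycle → 0 ≤ ∑ e ∈ C.edges.toFinset, c e)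
    {F : Finset (Sym2 V)} (hF : IsEvenEdgeSet s t F) (hFG : ∀ e ∈ F, e ∈ G.edgeSet) :
    0 ≤ ∑ e ∈ F, c e := by
  induction F using Finset.strongInduction with
  | _ F ih =>
  rcases F.eq_empty_or_nonempty with rfl | hne
  · simp
  obtain ⟨a, C, hC, hCF⟩ := hF.exists_isCycle hst hFG hne
  have hCne : C.edges.toFinset.Nonempty := by
    rw [List.toFinset_nonempty_iff, Ne, SimpleGraph.Walk.edges_eq_nil]
    exact hC.not_nil
  rw [← Finset.sum_sdiff hCF]
  refine add_nonneg (ih _ (Finset.sdiff_ssubset hCF hCne) (fun k => ?_) fun e he =>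
    hFG e (Finset.mem_sdiff.1 he).1) (hc a C hC)
  have := hF k
  rwa [← Finset.sum_sdiff hCF, hC.isEvenEdgeSet hst k, add_zero] at this

end SimpleGraph

lemma mem_cutFinset_iff {V : Type*} [Fintype V] [DecidableEq V] {G : SimpleGraph V}
    {s t : Sym2 V → V} (hst : ∀ e, s(s e, t e) = e) {X : Set V} {h : V → ZMod 2}
    (hX : ∀ v, v ∈ X ↔ h v = 0) {e : Sym2 V} :
    e ∈ cutFinset G X ↔ e ∈ G.edgeSet ∧ h (s e) ≠ h (t e) := by
  have h2 : ∀ a b, a ∈ X → b ∉ X → h a + h b ≠ 0 := fun a b ha hb => by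
    rw [hX] at ha hb
    rwa [ha, zero_add]
  simp only [cutFinset, Finset.mem_filter, Finset.mem_univ, true_and, and_congr_right_iff]
  intro _
  constructor
  · rintro ⟨a, b, rfl, ha, hb⟩ heq
    have := ends_add_ends hst h a b
    rw [heq, CharTwo.add_self_eq_zero] at this
    exact h2 a b ha hb this.symm
  · intro hne
    by_cases h0 : s e ∈ X
    · exact ⟨s e, t e, (hst e).symm, h0, fun h1 => hne
        (((hX _).1 h0).trans ((hX _).1 h1).symm)⟩
    · refine ⟨t e, s e, by rw [Sym2.eq_swap, hst], ?_, h0⟩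
      rw [hX] at h0 ⊢
      revert hne h0
      generalize h (s e) = i
      generalize h (t e) = j
      revert i j; decide

/-- For edge weights `p', w ≥ 0` and costs `c e = p' e − w e`, the
following are equivalent: (a) every simple cycle `C` satisfies `w(C) ≤ p'(C)`;
(b) `G` has no simple cycle of negative `c`-cost; (c) there is no `x ∈ ℝ^E` with `x ≥ 0`,
`x e ≤ x(B \ {e})` for every cut `B` and every `e ∈ B`, and `∑_{e ∈ E} c e * x e < 0`. -/
theorem tramp_steamer_lp_equivalences
    {V : Type*} [Fintype V] [DecidableEq V] (G : SimpleGraph V)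
    (p' w : Sym2 V → ℝ)
    (hp' : ∀ e ∈ G.edgeSet, 0 ≤ p' e) (hw : ∀ e ∈ G.edgeSet, 0 ≤ w e) :
    ((∀ (a : V) (C : G.Walk a a), C.IsCycle →
        (∑ e ∈ C.edges.toFinset, w e) ≤ ∑ e ∈ C.edges.toFinset, p' e) ↔
      ¬∃ (a : V) (C : G.Walk a a), C.IsCycle ∧
        (∑ e ∈ C.edges.toFinset, (p' e - w e)) < 0) ∧
    ((¬∃ (a : V) (C : G.Walk a a), C.IsCycle ∧
        (∑ e ∈ C.edges.toFinset, (p' e - w e)) < 0) ↔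
      ¬∃ x : Sym2 V → ℝ,
        (∀ e, 0 ≤ x e) ∧ (∀ e, e ∉ G.edgeSet → x e = 0) ∧
        (∀ X : Set V, X.Nonempty → X ≠ Set.univ →
          ∀ e ∈ cutFinset G X, x e ≤ ∑ f ∈ (cutFinset G X).erase e, x f) ∧
        (∑ e ∈ Finset.univ.filter (fun e => e ∈ G.edgeSet), (p' e - w e) * x e) < 0) := by
  refine ⟨?_, not_congr ⟨?_, ?_⟩⟩
  · push Not
    simp only [Finset.sum_sub_distrib, sub_nonneg]
  all_goals
    obtain ⟨s, t, hst⟩ : ∃ s t : Sym2 V → V, ∀ e, s(s e, t e) = e := by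
      have : ∀ e : Sym2 V, ∃ a b, s(a, b) = e := fun e => e.ind fun a b => ⟨a, b, rfl⟩
      choose s t hst using this
      exact ⟨s, t, hst⟩
  · rintro ⟨a, C, hC, hneg⟩
    have hCG : ∀ e ∈ C.edges.toFinset, e ∈ G.edgeSet := fun e he =>
      C.edges_subset_edgeSet (List.mem_toFinset.1 he)
    refine ⟨fun e => if e ∈ C.edges.toFinset then 1 else 0, fun e => ?_, fun e he => ?_,
      fun X _ _ e he => ?_, ?_⟩
    · dsimp only; split_ifs <;> norm_num
    · exact if_neg fun h => he (hCG e h)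
    · have hnn : ∀ f : Sym2 V, (0 : ℝ) ≤ if f ∈ C.edges.toFinset then 1 else 0 :=
        fun f => by split_ifs <;> norm_num
      by_cases heC : e ∈ C.edges.toFinset
      · set h : V → ZMod 2 := fun v => if v ∈ X then 0 else 1 with hh
        have hX : ∀ v, v ∈ X ↔ h v = 0 := fun v => by simp [hh]
        have heven := (hC.isEvenEdgeSet hst).even_card_cut h
        have hmem : e ∈ C.edges.toFinset.filter fun e => h (s e) ≠ h (t e) :=
          Finset.mem_filter.2 ⟨heC, ((mem_cutFinset_iff hst hX).1 he).2⟩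
        obtain ⟨f, hf, hfe⟩ := Finset.exists_mem_ne
          (s := C.edges.toFinset.filter fun e => h (s e) ≠ h (t e)) (by
            have := Finset.card_pos.2 ⟨e, hmem⟩
            obtain ⟨k, hk⟩ := heven
            omega) e
        rw [Finset.mem_filter] at hf
        have := Finset.single_le_sum (f := fun f => if f ∈ C.edges.toFinset then (1 : ℝ) else 0)
          (fun f _ => hnn f) (Finset.mem_erase.2
            ⟨hfe, (mem_cutFinset_iff hst hX).2 ⟨hCG f hf.1, hf.2⟩⟩)
        simp only [if_pos hf.1] at this
        simpa only [if_pos heC] using this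
      · beta_reduce
        rw [if_neg heC]
        exact Finset.sum_nonneg fun f _ => hnn f
    · refine lt_of_eq_of_lt ?_ hneg
      rw [sum_eq_sum_univ_ite C.edges.toFinset, Finset.sum_filter]
      refine Finset.sum_congr rfl fun e _ => ?_
      by_cases he : e ∈ C.edges.toFinset
      · simp only [if_pos he, if_pos (hCG e he), mul_one]
      · simp only [if_neg he, mul_zero, ite_self]
  · rintro ⟨x, hx0, hxG, hcut, hneg⟩
    by_contra hC
    push Not at hC
    have hsupp : ∀ e, x e ≠ 0 → e ∈ G.edgeSet := fun e he => by
      by_contra h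
      exact he (hxG e h)
    have hcone : InCutCone s t x := by
      refine ⟨hx0, fun h e => ?_⟩
      by_cases he : h (s e) = h (t e)
      · exact (cutSlack_of_eq he x).ge
      rw [cutSlack_of_ne he]
      have hnn : 0 ≤ ∑ f, if h (s f) = h (t f) then 0 else x f :=
        Finset.sum_nonneg fun f _ => by split_ifs; exacts [le_rfl, hx0 f]
      by_cases hxe : x e = 0
      · simpa [hxe] using hnn
      have hX : ∀ v, v ∈ {v | h v = 0} ↔ h v = 0 := fun v => Iff.rfl
      have heX : e ∈ cutFinset G {v | h v = 0} := (mem_cutFinset_iff hst hX).2 ⟨hsupp e hxe, he⟩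
      obtain ⟨-, a, b, -, ha, hb⟩ : e ∈ G.edgeSet ∧
          ∃ a b, e = s(a, b) ∧ a ∈ {v | h v = 0} ∧ b ∉ {v | h v = 0} := by
        simpa [cutFinset] using heX
      have h1 := hcut {v | h v = 0} ⟨a, ha⟩ (fun hu => hb (hu ▸ Set.mem_univ b)) e heX
      have h2 := Finset.add_sum_erase _ x heX
      have h3 : ∑ f ∈ cutFinset G {v | h v = 0}, x f =
          ∑ f, if h (s f) = h (t f) then 0 else x f := by
        rw [sum_eq_sum_univ_ite]
        refine Finset.sum_congr rfl fun f _ => ?_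
        by_cases hxf : x f = 0
        · simp [hxf]
        · simp only [mem_cutFinset_iff hst hX, hsupp f hxf, true_and, ne_eq, ite_not]
      linarith
    have := hcone.sum_mul_nonneg (c := fun e => p' e - w e) fun F hF hFx =>
      hF.sum_nonneg hst hC fun e he => hsupp e (hFx e he)
    refine hneg.not_ge (this.trans_eq ?_)
    rw [Finset.sum_filter]
    refine Finset.sum_congr rfl fun e _ => ?_
    split_ifs with h
    · rfl
    · rw [hxG e h, mul_zero]
end
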